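/- arXiv:2004.08158 — 4 statements merged into one kernel-verified Lean document; each statement's English description precedes it below -/
import Mathlib

section
/- For all integers n ≥ 0, the sequence Z_r(n,0) satisfies the second-order linear recurrence 16(n+1)³(2n+1)⁴(4n+3)(4n+5)(5460n⁴+35339n³+85858n²+92804n+37656)·Z_r(n,0) + (357913920n¹³ + 5716680688n¹² + 41762423804n¹¹ + 184637211081n¹⁰ + 550778114541n⁹ + 1169740743051n⁸ + 1818232366245n⁷ + 2092705983417n⁶ + 1782121652067n⁵ + 1108272850929n⁴ + 488951050619n³ + 144869028586n² + 25833166356n + 2094206184)·Z_r(n+1,0) + 8(n+2)⁴(2n+3)⁵(5460n⁴+13499n³+12601n²+5265n+831)·Z_r(n+2,0) = 0. -/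
open scoped BigOperators

/-- The Pochhammer symbol `(x)_k = x (x+1) ⋯ (x+k-1)` for a real `x`. -/
noncomputable def poch (x : ℝ) (k : ℕ) : ℝ := ∏ i ∈ Finset.range k, (x + i)

/-- The rational function `R_{n,m}(t)` from the paper. -/
noncomputable def R (n m : ℕ) (t : ℝ) : ℝ :=
  (-1 : ℝ) ^ m * (t + n / 2) * (poch (t - n) m / m.factorial) *
    (poch (t - 2 * n + m) (2 * n - m) / (2 * n - m).factorial) *
    (poch (t + n + 1) n / poch t (n + 1)) *
    (poch (t + n + 1) (2 * n - m) / poch t (2 * n - m + 1)) *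
    ((n.factorial : ℝ) / poch t (n + 1)) ^ 2

/-- The rational function `R̃_{n,m}(t)` from the paper. -/
noncomputable def Rtilde (n m : ℕ) (t : ℝ) : ℝ :=
  ((n.factorial : ℝ) * poch (t - n) (2 * n - m) / (poch t (n + 1) * poch t (2 * n - m + 1))) *
    ∑ j ∈ Finset.range (n + 1),
      (n.choose j : ℝ) ^ 2 * ((2 * n - m + j).choose n : ℝ) * poch (t - j) n / n.factorial

/-- `Z_l(n,m) = -(1/3) Σ_{ν=n-m+1}^∞ (d/dt R_{n,m}(t))|_{t=ν}`. -/
noncomputable def Zl (n m : ℕ) : ℝ :=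
  -(1 / 3) * ∑' ν : ℕ, deriv (R n m) ((n : ℝ) - m + 1 + ν)

/-- `Z_r(n,m) = (1/6) Σ_{ν=1}^∞ (d²/dt² R̃_{n,m}(t))|_{t=ν}`. -/
noncomputable def Zr (n m : ℕ) : ℝ :=
  (1 / 6) * ∑' ν : ℕ, deriv (deriv (Rtilde n m)) (1 + (ν : ℝ))

/-- `U_k(n) = Σ_{i=0}^n C(4i,2i) / ((2i+1)^k C(2i,i)^8)`. -/
noncomputable def U (k n : ℕ) : ℝ :=
  ∑ i ∈ Finset.range (n + 1),
    ((4 * i).choose (2 * i) : ℝ) / ((2 * i + 1) ^ k * ((2 * i).choose i : ℝ) ^ 8)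

/-- The harmonic number `S₁(N) = Σ_{i=1}^N 1/i`. -/
noncomputable def S1 (N : ℕ) : ℝ := ∑ i ∈ Finset.range N, (1 : ℝ) / (i + 1)

/-- The leading coefficient in `t` of the polynomial `beta1`. -/
noncomputable def lead (n : ℝ) : ℝ :=
  12912332160 * n ^ 13 + 184813471744 * n ^ 12 + 1203692510964 * n ^ 11 +
  4720611594861 * n ^ 10 + 12430648402607 * n ^ 9 + 23199134404289 * n ^ 8 +
  31559426251337 * n ^ 7 + 31680768036086 * n ^ 6 + 23468714382746 * n ^ 5 +
  12674174325403 * n ^ 4 + 4852225695691 * n ^ 3 + 1247811980537 * n ^ 2 + 193335771111 * n +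
  13641896448

/-- The coefficient in `beta0` of the part that does not vanish to second order at `t = 1`. -/
noncomputable def kap (n : ℝ) : ℝ :=
  -334152000 * n ^ 10 - 3907216800 * n ^ 9 - 20219848980 * n ^ 8 - 60904745348 * n ^ 7 -
  118100504906 * n ^ 6 - 153875550062 * n ^ 5 - 136314544960 * n ^ 4 - 81043568212 * n ^ 3 -
  30954666742 * n ^ 2 - 6864506634 * n - 672026652

/-- The terms of `beta1` of degree at most three in `t`. -/
noncomputable def betaLow (n t : ℝ) : ℝ :=
  (45577983360 * n ^ 14 + 688065820384 * n ^ 13 + 4760131120048 * n ^ 12 +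
  19994480103176 * n ^ 11 + 56948851978844 * n ^ 10 + 116321520569300 * n ^ 9 +
  175685524150308 * n ^ 8 + 199315010603528 * n ^ 7 + 170698968942120 * n ^ 6 +
  109848140396012 * n ^ 5 + 52304443105420 * n ^ 4 + 17877382479024 * n ^ 3 +
  4148604232988 * n ^ 2 + 585428624448 * n + 37926803232) * t ^ 3 + (30875470080 * n ^ 15 +
  450206545952 * n ^ 14 + 2963392534284 * n ^ 13 + 11581430720547 * n ^ 12 +
  29634130681564 * n ^ 11 + 51217084611715 * n ^ 10 + 58138813977203 * n ^ 9 +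
  35894491459307 * n ^ 8 - 5312221357843 * n ^ 7 - 36687466912306 * n ^ 6 -
  41029500428586 * n ^ 5 - 26706213182322 * n ^ 4 - 11290317646273 * n ^ 3 -
  3070069560773 * n ^ 2 - 490950286629 * n - 35241054480) * t ^ 2 + (-52824145920 * n ^ 16 -
  1020348322688 * n ^ 15 - 9104389786624 * n ^ 14 - 49822451122436 * n ^ 13 -
  187174187665933 * n ^ 12 - 511898504123852 * n ^ 11 - 1054257608758680 * n ^ 10 -
  1667888475356286 * n ^ 9 - 2048529536085922 * n ^ 8 - 1959918380532494 * n ^ 7 -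
  1455967862899010 * n ^ 6 - 831116414725416 * n ^ 5 - 357467235336641 * n ^ 4 -
  112021852228270 * n ^ 3 - 24130785379286 * n ^ 2 - 3193754823870 * n - 195751157328) * t +
  (-51033615360 * n ^ 17 - 967473755264 * n ^ 16 - 8514967167600 * n ^ 15 -
  46164900614532 * n ^ 14 - 172495431032902 * n ^ 13 - 470822053196646 * n ^ 12 -
  970706652235780 * n ^ 11 - 1541545636993611 * n ^ 10 - 1905180657096801 * n ^ 9 -
  1838231401324131 * n ^ 8 - 1380062687939067 * n ^ 7 - 797883490564403 * n ^ 6 -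
  348467240037089 * n ^ 5 - 111293309189223 * n ^ 4 - 24593334681721 * n ^ 3 -
  3390698018286 * n ^ 2 - 229192212816 * n - 2232150048)

/-- The terms of degree at most four in `t` of the part of `beta0` divisible by `(t - 1) ^ 2`. -/
noncomputable def rhoLow (n t : ℝ) : ℝ :=
  (72739255680 * n ^ 14 + 1077331455072 * n ^ 13 + 7299626115496 * n ^ 12 +
  29974759192450 * n ^ 11 + 83300043237398 * n ^ 10 + 165669485637202 * n ^ 9 +
  243117096318412 * n ^ 8 + 267406385413658 * n ^ 7 + 221546182082882 * n ^ 6 +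
  137620732280836 * n ^ 5 + 63118943304896 * n ^ 4 + 20737080914828 * n ^ 3 +
  4616153828232 * n ^ 2 + 623609083890 * n + 38598829884) * t ^ 4 + (155499402240 * n ^ 15 +
  2349992634336 * n ^ 14 + 16256953895324 * n ^ 13 + 68173945965175 * n ^ 12 +
  193409302693200 * n ^ 11 + 392178881856212 * n ^ 10 + 585150258930398 * n ^ 9 +
  651031815182673 * n ^ 8 + 540627913215474 * n ^ 7 + 331114146837004 * n ^ 6 +
  145111827376825 * n ^ 5 + 42566902068068 * n ^ 4 + 6970645061450 * n ^ 3 +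
  123309130376 * n ^ 2 - 164325372087 * n - 20918228076) * t ^ 3 + (144463038720 * n ^ 16 +
  2138360439488 * n ^ 15 + 14254406628616 * n ^ 14 + 56062626984954 * n ^ 13 +
  142123260404455 * n ^ 12 + 233304647382940 * n ^ 11 + 215915229507212 * n ^ 10 -
  2766588829146 * n ^ 9 - 349056407871549 * n ^ 8 - 601977364812150 * n ^ 7 -
  606887741428731 * n ^ 6 - 418617733052774 * n ^ 5 - 204243232319174 * n ^ 4 -
  69792064535874 * n ^ 3 - 15959204849637 * n ^ 2 - 2199494550510 * n - 138383430696) * t ^ 2 +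
  (48117888000 * n ^ 17 + 606681239040 * n ^ 16 + 2971026672576 * n ^ 15 +
  4924656081008 * n ^ 14 - 17433200017176 * n ^ 13 - 129634041495075 * n ^ 12 -
  404451828287760 * n ^ 11 - 809030212408915 * n ^ 10 - 1140265258944387 * n ^ 9 -
  1166699040789203 * n ^ 8 - 865869668962641 * n ^ 7 - 451261946849721 * n ^ 6 -
  149133424276949 * n ^ 5 - 19080967947146 * n ^ 4 + 7456476446745 * n ^ 3 +
  4333488211676 * n ^ 2 + 911575287096 * n + 75199936896) * t + (-670924800 * n ^ 18 -
  74883210240 * n ^ 17 - 1136216938240 * n ^ 16 - 8346046354240 * n ^ 15 -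
  37734661411976 * n ^ 14 - 115985285656446 * n ^ 13 - 254440140237823 * n ^ 12 -
  406964439698142 * n ^ 11 - 474250820964826 * n ^ 10 - 390213125484556 * n ^ 9 -
  202527426516052 * n ^ 8 - 32109010941304 * n ^ 7 + 44896867647002 * n ^ 6 +
  44841781220322 * n ^ 5 + 21592412470395 * n ^ 4 + 6192111639550 * n ^ 3 +
  1016491300128 * n ^ 2 + 74950233408 * n + 216898560)

/-- The middle coefficient of the recurrence `polySum_shift` in `t`. -/
noncomputable def shiftA1 (n t : ℝ) : ℝ :=
  -2 * t ^ 3 - (4 * n + 4) * t ^ 2 + (n ^ 2 - 3 * n - 3) * t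
    - (2 * n ^ 3 + 2 * n ^ 2 + 2 * n + 1)

/-- The coefficient of `polySum n t` in `polySum_step`. -/
noncomputable def stepQ0 (n t : ℝ) : ℝ :=
  (12 + 102 * n + 330 * n ^ 2 + 510 * n ^ 3 + 378 * n ^ 4 + 108 * n ^ 5)
    + (-20 - 165 * n - 460 * n ^ 2 - 531 * n ^ 3 - 216 * n ^ 4) * t
    + (1 + 69 * n + 213 * n ^ 2 + 171 * n ^ 3) * t ^ 2 + (33 + 105 * n + 85 * n ^ 2) * t ^ 3

/-- The coefficient of `t ^ 2 * polySum n (t + 1)` in `polySum_step`. -/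
noncomputable def stepQ1 (n t : ℝ) : ℝ :=
  -(85 * n ^ 2 + 105 * n + 33) * t - (86 * n ^ 3 + 108 * n ^ 2 + 36 * n + 1)

/-- The coefficient of `4 * polySum (n + 1) t` in `polySum_step`. -/
noncomputable def stepD (n : ℝ) : ℝ := (n + 1) ^ 2 * (2 * n + 1) ^ 2

/-- The polynomial coefficient of the shifted sum `polySum n (t + 1)` in `cert`. -/
noncomputable def beta1 (n t : ℝ) : ℝ := lead n * t ^ 4 + betaLow n t

/-- The polynomial coefficient of `polySum n t` in `cert`. -/
noncomputable def beta0 (n t : ℝ) : ℝ :=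
  beta1 n t * shiftA1 n (t - 1)
    + stepD n * kap n * ((t + 2 * n) * (t + n) * (t + n + 1) * (t + 2 * n + 1) * (t + 2 * n + 2)
      * (t + 2 * n + 3))
    + (t - 1) ^ 2 * (lead n * t ^ 5 + rhoLow n t)

/-- The coefficient of `Zr n 0` in the recurrence. -/
noncomputable def recC0 (n : ℝ) : ℝ :=
  16 * (n + 1) ^ 3 * (2 * n + 1) ^ 4 * (4 * n + 3) * (4 * n + 5) *
    (5460 * n ^ 4 + 35339 * n ^ 3 + 85858 * n ^ 2 + 92804 * n + 37656)

/-- The coefficient of `Zr (n + 1) 0` in the recurrence. -/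
noncomputable def recC1 (n : ℝ) : ℝ :=
  357913920 * n ^ 13 + 5716680688 * n ^ 12 + 41762423804 * n ^ 11
    + 184637211081 * n ^ 10 + 550778114541 * n ^ 9 + 1169740743051 * n ^ 8
    + 1818232366245 * n ^ 7 + 2092705983417 * n ^ 6 + 1782121652067 * n ^ 5
    + 1108272850929 * n ^ 4 + 488951050619 * n ^ 3 + 144869028586 * n ^ 2
    + 25833166356 * n + 2094206184

/-- The quotient of `recC2 n` by `4 * stepD (n + 1)`. -/
noncomputable def recC2r (n : ℝ) : ℝ :=
  2 * (n + 2) ^ 2 * (2 * n + 3) ^ 3 *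
    (5460 * n ^ 4 + 13499 * n ^ 3 + 12601 * n ^ 2 + 5265 * n + 831)

/-- The multiplier of the recurrence from `n + 1` to `n + 2` in `telescope_core`. -/
noncomputable def elimX (n t : ℝ) : ℝ := (t - n - 1) * (t - n - 2) * (t + n) * (t + n + 1)

/-- The multiplier of the recurrence from `n` to `n + 1` in `telescope_core`. -/
noncomputable def elimY (n t : ℝ) : ℝ :=
  recC1 n * (t - n - 1) * (t + n) * (t + n + 2) * (t + 2 * n + 3) * (t + 2 * n + 4)
    - recC2r n * elimX n t * stepQ0 (n + 1) t

/-- The multiplier of the shifted recurrence from `n` to `n + 1` in `telescope_core`. -/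
noncomputable def elimZ (n t : ℝ) : ℝ := -recC2r n * elimX n t * t ^ 2 * stepQ1 (n + 1) t

/-- The multiplier of the recurrence in `t` in `telescope_core`. -/
noncomputable def elimK (n t : ℝ) : ℝ :=
  recC2r n * (t - n - 1) * (t - n - 2) * (t + n) * t ^ 2 * stepQ1 (n + 1) t * stepQ1 n (t + 1)
    - t ^ 2 * (t + n) * beta1 n (t + 1)

set_option maxHeartbeats 4000000 in
theorem elim_coeff_zero (n t : ℝ) :
    4 * recC0 n * stepD n * (t + n + 1) * (t + n + 2)
        * ((t + 2 * n + 1) * (t + 2 * n + 2) * (t + 2 * n + 3) * (t + 2 * n + 4))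
      - elimY n t * stepQ0 n t + (t - n - 1) * (t + n + 2) * (t + 2 * n + 4) * beta0 n t
      - elimK n t * (t ^ 2 * (t + 3 * n + 1)) = 0 := by
  simp only [elimY, elimX, elimK, beta0, beta1, recC0, recC1, recC2r, stepD, stepQ0, stepQ1,
    lead, kap, betaLow, rhoLow, shiftA1]
  ring

set_option maxHeartbeats 4000000 in
theorem elim_coeff_one (n t : ℝ) :
    elimY n t * (t ^ 2 * stepQ1 n t) + elimZ n t * stepQ0 n (t + 1)
      + t ^ 2 * (t + n) * beta0 n (t + 1)
      - (t - n - 1) * (t + n + 2) * (t + 2 * n + 4) * (t ^ 2 * (t + n) * beta1 n t)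
      + elimK n t * shiftA1 n t = 0 := by
  simp only [elimY, elimX, elimZ, elimK, beta0, beta1, recC1, recC2r, stepD, stepQ0, stepQ1,
    lead, kap, betaLow, rhoLow, shiftA1]
  ring

theorem mul_poch_add_one (x : ℝ) (n : ℕ) : x * poch (x + 1) n = (x + n) * poch x n := by
  have h1 := Finset.prod_range_succ (fun i : ℕ => x + (i : ℝ)) n
  have h2 := Finset.prod_range_succ' (fun i : ℕ => x + (i : ℝ)) n
  rw [h1] at h2
  have h3 : ∀ i : ℕ, x + ((i + 1 : ℕ) : ℝ) = x + 1 + i := fun i => by push_cast; ring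
  simp only [h3, Nat.cast_zero, add_zero] at h2
  unfold poch
  linarith

theorem poch_succ (x : ℝ) (n : ℕ) : poch x (n + 1) = poch x n * (x + n) :=
  Finset.prod_range_succ _ _

theorem poch_add (x : ℝ) (m n : ℕ) : poch x (m + n) = poch x m * poch (x + m) n := by
  induction n with
  | zero => simp [poch]
  | succ k ih => rw [← add_assoc, poch_succ, ih, poch_succ]; push_cast; ring

/-- The weight of the summand of index `j` in `polySum`. -/
noncomputable def polyWeight (n j : ℕ) : ℝ := (n.choose j : ℝ) ^ 2 * ((2 * n + j).choose n : ℝ)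

/-- The polynomial `n!` times the sum occurring in `Rtilde n 0`. -/
noncomputable def polySum (n : ℕ) (t : ℝ) : ℝ :=
  ∑ j ∈ Finset.range (n + 1), polyWeight n j * poch (t - j) n

theorem continuous_polySum (n : ℕ) : Continuous (polySum n) := by
  unfold polySum poch
  fun_prop

theorem eq_zero_of_eq_zero_off_int {f : ℝ → ℝ} (hf : Continuous f)
    (h : ∀ t : ℝ, (∀ k : ℤ, t ≠ k) → f t = 0) (t : ℝ) : f t = 0 := by
  have hd : Dense ((Set.range ((↑) : ℤ → ℝ))ᶜ) :=
    (Set.countable_range _).dense_compl ℝ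
  have := Continuous.ext_on hd hf continuous_const (g := fun _ => (0 : ℝ)) (fun x hx =>
    h x fun k hk => hx ⟨k, hk.symm⟩)
  exact congrFun this t

theorem choose_succ_mul (n j : ℕ) (hj : j ≤ n) :
    ((j : ℝ) + 1) * (n.choose (j + 1) : ℝ) = ((n : ℝ) - j) * (n.choose j : ℝ) := by
  have := Nat.choose_succ_right_eq n j
  have h2 : ((n.choose (j + 1) * (j + 1) : ℕ) : ℝ) = ((n.choose j * (n - j) : ℕ) : ℝ) := by
    rw [this]
  push_cast [Nat.cast_sub hj] at h2
  linarith

theorem choose_upper_succ_mul (n j : ℕ) :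
    ((n : ℝ) + j + 1) * ((2 * n + (j + 1)).choose n : ℝ)
      = (2 * n + j + 1) * ((2 * n + j).choose n : ℝ) := by
  have h := Nat.choose_mul_succ_eq (2 * n + j) n
  have h1 : 2 * n + j + 1 - n = n + j + 1 := by omega
  rw [h1] at h
  have h2 : (((2 * n + j).choose n * (2 * n + j + 1) : ℕ) : ℝ)
      = (((2 * n + j + 1).choose n * (n + j + 1) : ℕ) : ℝ) := by rw [h]
  push_cast at h2
  rw [← add_assoc]
  linarith

theorem polyWeight_succ_mul (n j : ℕ) (hj : j ≤ n) :
    ((j : ℝ) + 1) ^ 2 * (n + j + 1) * polyWeight n (j + 1)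
      = ((n : ℝ) - j) ^ 2 * (2 * n + j + 1) * polyWeight n j := by
  unfold polyWeight
  have h1 := choose_succ_mul n j hj
  have h2 := choose_upper_succ_mul n j
  calc _ = (((j : ℝ) + 1) * (n.choose (j + 1) : ℝ)) ^ 2
        * (((n : ℝ) + j + 1) * ((2 * n + (j + 1)).choose n : ℝ)) := by ring
    _ = _ := by rw [h1, h2]; ring

theorem polySum_shift_off_int (n : ℕ) (t : ℝ) (ht : ∀ k : ℤ, t ≠ k) :
    t ^ 2 * (t + 3 * n + 1) * polySum n t + shiftA1 n t * polySum n (t + 1)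
      + (t + n + 1) * (t + 1) ^ 2 * polySum n (t + 2) = 0 := by
  set Y : ℕ → ℝ := fun j => -n * j ^ 2 * (n + j) * (t - j + n) / ((t - j) * (t - j + 1))
    * (polyWeight n j * poch (t - j) n) with hY
  have key : ∀ j ∈ Finset.range (n + 1),
      t ^ 2 * (t + 3 * n + 1) * (polyWeight n j * poch (t - j) n)
        + shiftA1 n t * (polyWeight n j * poch (t + 1 - j) n)
        + (t + n + 1) * (t + 1) ^ 2 * (polyWeight n j * poch (t + 2 - j) n) = Y (j + 1) - Y j := by
    intro j hj
    have hjn : j ≤ n := by simpa [Nat.lt_succ_iff] using hj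
    have n0 : t - j ≠ 0 := sub_ne_zero.2 (by simpa using ht j)
    have n1 : t - j + 1 ≠ 0 := by
      have := ht (j - 1); push_cast at this
      intro h; apply this; linarith
    have n2 : t - j - 1 ≠ 0 := by
      have := ht (j + 1); push_cast at this
      intro h; apply this; linarith
    have hP1 := mul_poch_add_one (t - j) n
    have hP2 := mul_poch_add_one (t - j + 1) n
    have hPm := mul_poch_add_one (t - j - 1) n
    have hw := polyWeight_succ_mul n j hjn
    rw [show t - j + 1 = t + 1 - j by ring] at hP1
    rw [show t - j + 1 + 1 = t + 2 - j by ring, show poch (t - j + 1) n = poch (t + 1 - j) n by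
      congr 1; ring] at hP2
    rw [show t - j - 1 + 1 = t - j by ring] at hPm
    have e1 : poch (t + 1 - j) n = (t - j + n) * poch (t - j) n / (t - j) := by
      field_simp; linarith
    have e2 : poch (t + 2 - j) n
        = (t - j + 1 + n) * ((t - j + n) * poch (t - j) n / (t - j)) / (t - j + 1) := by
      rw [← e1]; field_simp; linarith
    have e3 : Y (j + 1) = -n * (((n : ℝ) - j) ^ 2 * (2 * n + j + 1) * polyWeight n j)
        * poch (t - j) n / (t - j) := by
      simp only [hY]
      rw [← hw]
      push_cast
      rw [show t - ((j : ℝ) + 1) = t - j - 1 by ring, show t - (j : ℝ) - 1 + 1 = t - j by ring]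
      have e4 : poch (t - j) n = (t - j - 1 + n) * poch (t - j - 1) n / (t - j - 1) := by
        field_simp; linarith
      rw [e4]
      field_simp
      ring
    rw [e3, e1, e2]
    simp only [hY]
    unfold shiftA1
    field_simp
    ring
  have hs := Finset.sum_congr rfl key
  rw [Finset.sum_range_sub] at hs
  simp only [Finset.sum_add_distrib, ← Finset.mul_sum] at hs
  have hY0 : Y 0 = 0 := by simp [hY]
  have hYn : Y (n + 1) = 0 := by simp [hY, polyWeight]
  rw [hY0, hYn, sub_zero] at hs
  exact hs

theorem polySum_shift (n : ℕ) (t : ℝ) :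
    t ^ 2 * (t + 3 * n + 1) * polySum n t + shiftA1 n t * polySum n (t + 1)
      + (t + n + 1) * (t + 1) ^ 2 * polySum n (t + 2) = 0 := by
  refine eq_zero_of_eq_zero_off_int ?_ (polySum_shift_off_int n) t
  have := continuous_polySum n
  unfold shiftA1
  fun_prop

/-- The polynomial factor of the telescoping certificate for `polySum_step`. -/
noncomputable def stepCert (n t x : ℝ) : ℝ :=
  (1 + t + 38 * n - 40 * n * t + 181 * n ^ 2 - 183 * n ^ 2 * t + 338 * n ^ 3 - 261 * n ^ 3 * t
      + 280 * n ^ 4 - 119 * n ^ 4 * t + 86 * n ^ 5)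
    + (30 - 46 * t + 137 * n - 163 * n * t + 223 * n ^ 2 - 168 * n ^ 2 * t + 148 * n ^ 3
      - 38 * n ^ 3 * t + 32 * n ^ 4) * x
    + (-19 + 33 * t - 77 * n + 105 * n * t - 104 * n ^ 2 + 85 * n ^ 2 * t - 46 * n ^ 3) * x ^ 2

theorem succ_mul_choose_eq_real (n j : ℕ) (hj : j ≤ n + 1) :
    ((n : ℝ) + 1) * (n.choose j : ℝ) = ((n : ℝ) + 1 - j) * ((n + 1).choose j : ℝ) := by
  have h := Nat.choose_mul_succ_eq n j
  have h2 : ((n.choose j * (n + 1) : ℕ) : ℝ) = (((n + 1).choose j * (n + 1 - j) : ℕ) : ℝ) := by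
    rw [h]
  push_cast [Nat.cast_sub hj] at h2
  linarith

theorem choose_diag_step (n j : ℕ) :
    ((n : ℝ) + 1) * (n + j + 1) * ((2 * (n + 1) + j).choose (n + 1) : ℝ)
      = (2 * n + j + 2) * (2 * n + j + 1) * ((2 * n + j).choose n : ℝ) := by
  have h1 := Nat.add_one_mul_choose_eq (2 * n + j + 1) n
  have h2 := choose_upper_succ_mul n j
  have h3 : (((2 * n + j + 1 + 1) * (2 * n + j + 1).choose n : ℕ) : ℝ)
      = (((2 * n + j + 1 + 1).choose (n + 1) * (n + 1) : ℕ) : ℝ) := by rw [h1]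
  rw [show 2 * (n + 1) + j = 2 * n + j + 1 + 1 by ring]
  rw [← add_assoc] at h2
  push_cast at h3
  linear_combination (-(n : ℝ) - j - 1) * h3 + (2 * n + j + 2) * h2

theorem polySum_step_off_int (n : ℕ) (t : ℝ) (ht : ∀ k : ℤ, t ≠ k) :
    4 * stepD n * polySum (n + 1) t + stepQ0 n t * polySum n t
      + t ^ 2 * stepQ1 n t * polySum n (t + 1) = 0 := by
  set Y : ℕ → ℝ := fun j => j ^ 2 * (t - j + n) / (t - j) * (stepCert n t j / (n + 1) ^ 2)
    * (((n + 1).choose j : ℝ) ^ 2 * ((2 * n + j).choose n : ℝ) * poch (t - j) n) with hY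
  have key : ∀ j ∈ Finset.range (n + 1 + 1),
      4 * stepD n * (polyWeight (n + 1) j * poch (t - j) (n + 1))
        + stepQ0 n t * (polyWeight n j * poch (t - j) n)
        + t ^ 2 * stepQ1 n t * (polyWeight n j * poch (t + 1 - j) n) = Y (j + 1) - Y j := by
    intro j hj
    have hjn : j ≤ n + 1 := by simpa [Nat.lt_succ_iff] using hj
    have n0 : t - j ≠ 0 := sub_ne_zero.2 (by simpa using ht j)
    have n2 : t - j - 1 ≠ 0 := by
      have := ht (j + 1); push_cast at this
      intro h; apply this; linarith
    have m1 : (n : ℝ) + 1 ≠ 0 := by positivity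
    have m2 : (n : ℝ) + j + 1 ≠ 0 := by positivity
    have hP1 := mul_poch_add_one (t - j) n
    have hPm := mul_poch_add_one (t - j - 1) n
    rw [show t - j + 1 = t + 1 - j by ring] at hP1
    rw [show t - j - 1 + 1 = t - j by ring] at hPm
    have e1 : poch (t + 1 - j) n = (t - j + n) * poch (t - j) n / (t - j) := by
      field_simp; linarith
    have w1 : polyWeight (n + 1) j = ((n + 1).choose j : ℝ) ^ 2
        * ((2 * n + j + 2) * (2 * n + j + 1) * ((2 * n + j).choose n : ℝ)
          / ((n + 1) * (n + j + 1))) := by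
      have := choose_diag_step n j
      unfold polyWeight
      rw [← this]; field_simp
    have w0 : polyWeight n j = ((n : ℝ) + 1 - j) ^ 2 / (n + 1) ^ 2
        * (((n + 1).choose j : ℝ) ^ 2 * ((2 * n + j).choose n : ℝ)) := by
      have : (n.choose j : ℝ) = ((n : ℝ) + 1 - j) * ((n + 1).choose j : ℝ) / (n + 1) := by
        rw [← succ_mul_choose_eq_real n j hjn]; field_simp
      unfold polyWeight
      rw [this]; field_simp
    have e3 : Y (j + 1) = stepCert n t (j + 1) / (n + 1) ^ 2 * (n + 1 - j) ^ 2
        * ((2 * n + j + 1) / (n + j + 1))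
        * (((n + 1).choose j : ℝ) ^ 2 * ((2 * n + j).choose n : ℝ) * poch (t - j) n) := by
      have h1 := choose_succ_mul (n + 1) j hjn
      have h2 : ((2 * n + (j + 1)).choose n : ℝ)
          = (2 * n + j + 1) / (n + j + 1) * ((2 * n + j).choose n : ℝ) := by
        have := choose_upper_succ_mul n j
        field_simp; linarith
      have e4 : poch (t - j) n = (t - j - 1 + n) * poch (t - j - 1) n / (t - j - 1) := by
        field_simp; linarith
      push_cast at h1
      calc Y (j + 1) = (t - j - 1 + n) / (t - j - 1) * (stepCert n t (j + 1) / (n + 1) ^ 2)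
            * ((((j : ℝ) + 1) * ((n + 1).choose (j + 1) : ℝ)) ^ 2
              * ((2 * n + (j + 1)).choose n : ℝ) * poch (t - j - 1) n) := by
            simp only [hY]
            push_cast
            rw [show t - ((j : ℝ) + 1) = t - j - 1 by ring]
            ring
        _ = _ := by rw [h1, h2, e4]; ring
    rw [e3, e1, w1, w0, poch_succ]
    simp only [hY]
    unfold stepCert stepD stepQ0 stepQ1
    field_simp
    ring
  have hs := Finset.sum_congr rfl key
  rw [Finset.sum_range_sub] at hs
  simp only [Finset.sum_add_distrib, ← Finset.mul_sum] at hs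
  have hY0 : Y 0 = 0 := by simp [hY]
  have hYn : Y (n + 1 + 1) = 0 := by simp [hY]
  rw [hY0, hYn, sub_zero, Finset.sum_range_succ (fun j => polyWeight n j * poch (t - j) n),
    Finset.sum_range_succ (fun j => polyWeight n j * poch (t + 1 - j) n)] at hs
  have hw : polyWeight n (n + 1) = 0 := by simp [polyWeight]
  rw [hw, zero_mul, zero_mul, add_zero, add_zero] at hs
  exact hs

theorem polySum_step (n : ℕ) (t : ℝ) :
    4 * stepD n * polySum (n + 1) t + stepQ0 n t * polySum n t
      + t ^ 2 * stepQ1 n t * polySum n (t + 1) = 0 := by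
  refine eq_zero_of_eq_zero_off_int ?_ (polySum_step_off_int n) t
  have := continuous_polySum n
  have := continuous_polySum (n + 1)
  unfold stepD stepQ0 stepQ1
  fun_prop

/-- The coefficient of `Zr (n + 2) 0` in the recurrence. -/
noncomputable def recC2 (n : ℝ) : ℝ :=
  8 * (n + 2) ^ 4 * (2 * n + 3) ^ 5 *
    (5460 * n ^ 4 + 13499 * n ^ 3 + 12601 * n ^ 2 + 5265 * n + 831)

theorem telescope_core (n t s s' s'' u u' v : ℝ)
    (hA : t ^ 2 * (t + 3 * n + 1) * s + shiftA1 n t * s' + (t + n + 1) * (t + 1) ^ 2 * s'' = 0)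
    (hB : 4 * stepD n * u + stepQ0 n t * s + t ^ 2 * stepQ1 n t * s' = 0)
    (hB' : 4 * stepD n * u' + stepQ0 n (t + 1) * s' + (t + 1) ^ 2 * stepQ1 n (t + 1) * s'' = 0)
    (hC : 4 * stepD (n + 1) * v + stepQ0 (n + 1) t * u + t ^ 2 * stepQ1 (n + 1) t * u' = 0) :
    4 * recC0 n * stepD n * (t + n + 1) * (t + n + 2)
        * ((t + 2 * n + 1) * (t + 2 * n + 2) * (t + 2 * n + 3) * (t + 2 * n + 4)) * s
      + 4 * recC1 n * stepD n * (t - n - 1) * (t + n) * (t + n + 2) * (t + 2 * n + 3)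
        * (t + 2 * n + 4) * u
      + 4 * recC2 n * stepD n * (t - n - 1) * (t - n - 2) * (t + n) * (t + n + 1) * v
      = t ^ 2 * (t + n) * (beta0 n (t + 1) * s' + (t + 1) ^ 2 * (t + 1 + n) * beta1 n (t + 1) * s'')
        - (t - n - 1) * (t + n + 2) * (t + 2 * n + 4)
          * (beta0 n t * s + t ^ 2 * (t + n) * beta1 n t * s') := by
  have h0 := elim_coeff_zero n t
  have h1 := elim_coeff_one n t
  have h2 : recC2 n = 4 * stepD (n + 1) * recC2r n := by unfold recC2 stepD recC2r; ring
  rw [h2]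
  have hX : elimX n t = (t - n - 1) * (t - n - 2) * (t + n) * (t + n + 1) := rfl
  have hY : elimY n t = recC1 n * (t - n - 1) * (t + n) * (t + n + 2) * (t + 2 * n + 3)
    * (t + 2 * n + 4) - recC2r n * elimX n t * stepQ0 (n + 1) t := rfl
  have hZ : elimZ n t = -recC2r n * elimX n t * t ^ 2 * stepQ1 (n + 1) t := rfl
  have hK : elimK n t = recC2r n * (t - n - 1) * (t - n - 2) * (t + n) * t ^ 2
    * stepQ1 (n + 1) t * stepQ1 n (t + 1) - t ^ 2 * (t + n) * beta1 n (t + 1) := rfl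
  rw [hY, hZ, hX, hK] at h1
  rw [hY, hX, hK] at h0
  linear_combination
    4 * stepD n * ((t - n - 1) * (t - n - 2) * (t + n) * (t + n + 1)) * recC2r n * hC
    + (recC1 n * (t - n - 1) * (t + n) * (t + n + 2) * (t + 2 * n + 3) * (t + 2 * n + 4)
      - recC2r n * ((t - n - 1) * (t - n - 2) * (t + n) * (t + n + 1)) * stepQ0 (n + 1) t) * hB
    - recC2r n * ((t - n - 1) * (t - n - 2) * (t + n) * (t + n + 1)) * t ^ 2
      * stepQ1 (n + 1) t * hB'
    + (recC2r n * (t - n - 1) * (t - n - 2) * (t + n) * t ^ 2 * stepQ1 (n + 1) t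
      * stepQ1 n (t + 1) - t ^ 2 * (t + n) * beta1 n (t + 1)) * hA
    + s * h0 - s' * h1

theorem poch_succ_left (x : ℝ) (n : ℕ) : poch x (n + 1) = x * poch (x + 1) n := by
  rw [mul_poch_add_one, poch_succ, mul_comm]

theorem poch_pos {x : ℝ} (hx : 0 < x) (n : ℕ) : 0 < poch x n :=
  Finset.prod_pos fun i _ => by positivity

theorem Rtilde_zero_eq (n : ℕ) {t : ℝ} (ht : 0 < t) :
    Rtilde n 0 t = poch (t - n) n * polySum n t / ((t + n) * poch t (2 * n + 1)) := by
  have hsum : ∑ j ∈ Finset.range (n + 1),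
      (n.choose j : ℝ) ^ 2 * ((2 * n - 0 + j).choose n : ℝ) * poch (t - j) n / n.factorial
      = polySum n t / n.factorial := by
    rw [polySum, Finset.sum_div]
    rfl
  have h1 : poch (t - n) (2 * n - 0) = poch (t - n) n * poch t n := by
    rw [Nat.sub_zero, two_mul, poch_add, sub_add_cancel]
  have p1 := (poch_pos ht n).ne'
  have p2 := (poch_pos ht (2 * n + 1)).ne'
  have p3 : t + n ≠ 0 := by positivity
  have p4 : (n.factorial : ℝ) ≠ 0 := by positivity
  rw [Rtilde, hsum, h1, poch_succ t n, Nat.sub_zero]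
  field_simp

/-- The certificate whose differences give the recurrence combination of the `Rtilde n 0`. -/
noncomputable def cert (n : ℕ) (t : ℝ) : ℝ :=
  poch (t - n - 1) (n + 1)
    * (beta0 n t * polySum n t + t ^ 2 * (t + n) * beta1 n t * polySum n (t + 1))
    / (4 * stepD n * (t + n) * (t + n + 1) * poch t (2 * n + 4))

theorem Rtilde_telescope (n : ℕ) {t : ℝ} (ht : 0 < t) :
    recC0 n * Rtilde n 0 t + recC1 n * Rtilde (n + 1) 0 t + recC2 n * Rtilde (n + 2) 0 t
      = cert n (t + 1) - cert n t := by
  have hA := polySum_shift n t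
  have hB := polySum_step n t
  have hB' := polySum_step n (t + 1)
  have hC := polySum_step (n + 1) t
  rw [show t + 1 + 1 = t + 2 by ring] at hB'
  push_cast at hC
  have core := telescope_core n t _ _ _ _ _ _ hA hB hB' hC
  rw [Rtilde_zero_eq n ht, Rtilde_zero_eq (n + 1) ht, Rtilde_zero_eq (n + 2) ht, cert, cert]
  have hL := (poch_pos ht (2 * n + 1)).ne'
  have hw1 : poch (t - (n + 1 : ℕ)) (n + 1) = (t - n - 1) * poch (t - n) n := by
    rw [poch_succ_left, Nat.cast_succ, sub_add_eq_sub_sub, sub_add_cancel]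
  have hw2 : poch (t - (n + 2 : ℕ)) (n + 2) = (t - n - 2) * ((t - n - 1) * poch (t - n) n) := by
    rw [poch_succ_left, ← hw1, show t - ((n + 2 : ℕ) : ℝ) + 1 = t - (n + 1 : ℕ) by push_cast; ring]
    push_cast; ring
  have hw3 : poch (t - n - 1) (n + 1) = (t - n - 1) * poch (t - n) n := by
    rw [poch_succ_left, sub_add_cancel]
  have hw4 : poch (t + 1 - n - 1) (n + 1) = t * poch (t - n) n := by
    rw [show t + 1 - n - 1 = t - n by ring, poch_succ]; ring
  have hd1 : poch t (2 * (n + 1) + 1)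
      = poch t (2 * n + 1) * (t + 2 * n + 1) * (t + 2 * n + 2) := by
    rw [show 2 * (n + 1) + 1 = 2 * n + 1 + 1 + 1 by ring, poch_succ, poch_succ]
    push_cast; ring
  have hd3 : poch t (2 * n + 4)
      = poch t (2 * n + 1) * (t + 2 * n + 1) * (t + 2 * n + 2) * (t + 2 * n + 3) := by
    rw [show 2 * n + 4 = 2 * (n + 1) + 1 + 1 by ring, poch_succ, hd1]
    push_cast; ring
  have hd2 : poch t (2 * (n + 2) + 1) = poch t (2 * n + 1) * (t + 2 * n + 1) * (t + 2 * n + 2)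
      * (t + 2 * n + 3) * (t + 2 * n + 4) := by
    rw [show 2 * (n + 2) + 1 = 2 * n + 4 + 1 by ring, poch_succ, hd3]
    push_cast; ring
  have hd4 : poch (t + 1) (2 * n + 4) = poch t (2 * n + 1) * (t + 2 * n + 1) * (t + 2 * n + 2)
      * (t + 2 * n + 3) * (t + 2 * n + 4) / t := by
    rw [← hd2, show 2 * (n + 2) + 1 = 2 * n + 4 + 1 by ring, poch_succ_left t (2 * n + 4)]
    field_simp
  have hD : stepD n ≠ 0 := by unfold stepD; positivity
  rw [hw1, hw2, hw3, hw4, hd1, hd2, hd3, hd4]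
  rw [show t + 1 + 1 = t + 2 by ring]
  push_cast
  set W := poch (t - n) n
  set L := poch t (2 * n + 1)
  have q0 : t ≠ 0 := ht.ne'
  have q1 : t + n ≠ 0 := by positivity
  have q2 : t + n + 1 ≠ 0 := by positivity
  have q3 : t + n + 2 ≠ 0 := by positivity
  have r1 : t + 2 * n + 1 ≠ 0 := by positivity
  have r2 : t + 2 * n + 2 ≠ 0 := by positivity
  have r3 : t + 2 * n + 3 ≠ 0 := by positivity
  have r4 : t + 2 * n + 4 ≠ 0 := by positivity
  rw [show t + ((n : ℝ) + 1) = t + n + 1 by ring, show t + ((n : ℝ) + 2) = t + n + 2 by ring,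
    show t + 1 + (n : ℝ) = t + n + 1 by ring, show t + (n : ℝ) + 1 + 1 = t + n + 2 by ring]
  rw [show t + 1 + (n : ℝ) = t + n + 1 by ring] at core
  have lhs_eq : recC0 n * (W * polySum n t / ((t + n) * L))
      + recC1 n * ((t - n - 1) * W * polySum (n + 1) t
        / ((t + n + 1) * (L * (t + 2 * n + 1) * (t + 2 * n + 2))))
      + recC2 n * ((t - n - 2) * ((t - n - 1) * W) * polySum (n + 2) t
        / ((t + n + 2) * (L * (t + 2 * n + 1) * (t + 2 * n + 2) * (t + 2 * n + 3)
          * (t + 2 * n + 4))))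
      = W / (4 * stepD n * (t + n) * (t + n + 1) * (t + n + 2) * L * ((t + 2 * n + 1)
          * (t + 2 * n + 2) * (t + 2 * n + 3) * (t + 2 * n + 4)))
        * (4 * recC0 n * stepD n * (t + n + 1) * (t + n + 2)
          * ((t + 2 * n + 1) * (t + 2 * n + 2) * (t + 2 * n + 3) * (t + 2 * n + 4)) * polySum n t
        + 4 * recC1 n * stepD n * (t - n - 1) * (t + n) * (t + n + 2) * (t + 2 * n + 3)
          * (t + 2 * n + 4) * polySum (n + 1) t
        + 4 * recC2 n * stepD n * (t - n - 1) * (t - n - 2) * (t + n) * (t + n + 1)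
          * polySum (n + 2) t) := by
    field_simp
  rw [lhs_eq, core]
  field_simp

theorem contDiff_poch (n : ℕ) : ContDiff ℝ 2 fun t => poch t n := by
  unfold poch
  exact contDiff_prod fun i _ => by fun_prop

theorem contDiff_polySum (n : ℕ) : ContDiff ℝ 2 (polySum n) := by
  unfold polySum
  exact ContDiff.sum fun j _ => contDiff_const.mul ((contDiff_poch n).comp (by fun_prop))

theorem hasDerivAt_sub_one_sq_mul {g : ℝ → ℝ} (hg : DifferentiableAt ℝ g 1) :
    HasDerivAt (fun t => (t - 1) ^ 2 * g t) 0 1 := by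
  have h := (((hasDerivAt_id' (1 : ℝ)).sub_const 1).fun_pow 2).fun_mul hg.hasDerivAt
  simpa using h

theorem deriv_deriv_eq_zero_of_eventuallyEq_mul {f u : ℝ → ℝ}
    (hf : f =ᶠ[nhds 1] fun t => (t - 1) * u t) (hu : ContDiffAt ℝ 2 u 1)
    (hu' : HasDerivAt u 0 1) : deriv (deriv f) 1 = 0 := by
  have h1 : ∀ᶠ t in nhds (1 : ℝ), DifferentiableAt ℝ u t :=
    ((hu.eventually (by simp)).mono fun t ht => ht.differentiableAt (by simp))
  have h2 : deriv f =ᶠ[nhds 1] fun t => u t + (t - 1) * deriv u t := by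
    filter_upwards [hf.eventuallyEq_nhds, h1] with t ht htu
    rw [ht.deriv_eq]
    have := ((hasDerivAt_id' t).sub_const 1).fun_mul htu.hasDerivAt
    simpa using this.deriv
  rw [h2.deriv_eq]
  have h3 : DifferentiableAt ℝ (deriv u) 1 :=
    (hu.derivWithin (m := 1) (by norm_num)).differentiableAt (by simp)
  have h4 := hu'.fun_add (((hasDerivAt_id' (1 : ℝ)).sub_const 1).fun_mul h3.hasDerivAt)
  have h5 := h4.deriv
  simpa [hu'.deriv] using h5

theorem polySum_shift_back (n : ℕ) (t : ℝ) :
    t ^ 2 * (t + n) * polySum n (t + 1) = -shiftA1 n (t - 1) * polySum n t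
      - (t - 1) ^ 2 * (t + 3 * n) * polySum n (t - 1) := by
  have h := polySum_shift n (t - 1)
  rw [show t - 1 + 1 = t by ring, show t - 1 + 2 = t + 1 by ring] at h
  linear_combination h

/-- The polynomial remainder in `polySum_step_back`. -/
noncomputable def stepRem (n t : ℝ) : ℝ :=
  (85 * n ^ 2 + 105 * n + 33) * t ^ 3 + (171 * n ^ 3 + 43 * n ^ 2 - 141 * n - 65) * t ^ 2
    + (64 * n ^ 4 - 222 * n ^ 3 - 289 * n ^ 2 - 46 * n + 22) * t
    + (-32 * n ^ 5 - 192 * n ^ 4 - 153 * n ^ 3 - n ^ 2 + 18 * n)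

theorem polySum_step_back (n : ℕ) (t : ℝ) :
    (t - n - 2) * (4 * stepD n * (t + n) * polySum (n + 1) t)
      = -(4 * stepD n * ((t + n) * (t + 2 * n + 1) * (t + 2 * n))) * polySum n t
        + (t - 1) ^ 2 * (stepRem n t * polySum n t
          + (t - n - 2) * stepQ1 n t * (t + 3 * n) * polySum n (t - 1)) := by
  have hB := polySum_step n t
  have hA := polySum_shift_back n t
  have hr : (t - n - 2) * (-(t + n) * stepQ0 n t + stepQ1 n t * shiftA1 n (t - 1))
      = -(4 * stepD n * ((t + n) * (t + 2 * n + 1) * (t + 2 * n)))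
        + (t - 1) ^ 2 * stepRem n t := by
    unfold stepQ0 stepQ1 shiftA1 stepD stepRem
    ring
  linear_combination (t - n - 2) * (t + n) * hB - (t - n - 2) * stepQ1 n t * hA
    + polySum n t * hr

/-- The value of `cert` near `1`, to first order and up to a constant factor, is `t - 1` times
this function. -/
noncomputable def certLead (n : ℕ) (t : ℝ) : ℝ :=
  (t + 2 * n) * poch (t - n - 1) n * polySum n t / poch t (2 * n + 1)

theorem hasDerivAt_certLead (n : ℕ) : HasDerivAt (certLead n) 0 1 := by
  induction n with
  | zero =>
    refine (hasDerivAt_const (1 : ℝ) (1 : ℝ)).congr_of_eventuallyEq ?_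
    filter_upwards [lt_mem_nhds (zero_lt_one : (0 : ℝ) < 1)] with t ht
    have : t ≠ 0 := ht.ne'
    simp [certLead, poch, polySum, polyWeight, this]
  | succ n ih =>
    set E : ℝ → ℝ := fun t => poch (t - n - 1) n * (stepRem n t * polySum n t
      + (t - n - 2) * stepQ1 n t * (t + 3 * n) * polySum n (t - 1))
      / (4 * stepD n * (t + n) * (t + 2 * n + 1) * poch t (2 * n + 1)) with hE
    have hD : stepD n ≠ 0 := by unfold stepD; positivity
    have hE1 : DifferentiableAt ℝ E 1 := by
      have h1 := (contDiff_poch n).differentiable (by simp)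
      have h2 := (contDiff_poch (2 * n + 1)).differentiable (by simp)
      have h3 := (contDiff_polySum n).differentiable (by simp)
      refine DifferentiableAt.fun_div ?_ ?_ ?_
      · unfold stepRem stepQ1
        have h4 : Differentiable ℝ fun t : ℝ => poch (t - n - 1) n :=
          h1.comp (f := fun t : ℝ => t - n - 1) (by fun_prop)
        fun_prop
      · fun_prop
      · have := (poch_pos one_pos (2 * n + 1)).ne'
        positivity
    have hU : certLead (n + 1) =ᶠ[nhds 1] fun t => -certLead n t + (t - 1) ^ 2 * E t := by
      filter_upwards [lt_mem_nhds (zero_lt_one : (0 : ℝ) < 1)] with t ht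
      have hL := (poch_pos ht (2 * n + 1)).ne'
      have hd1 : poch t (2 * (n + 1) + 1)
          = poch t (2 * n + 1) * (t + 2 * n + 1) * (t + 2 * n + 2) := by
        rw [show 2 * (n + 1) + 1 = 2 * n + 1 + 1 + 1 by ring, poch_succ, poch_succ]
        push_cast; ring
      have hw : poch (t - (n + 1 : ℕ) - 1) (n + 1) = (t - n - 2) * poch (t - n - 1) n := by
        rw [poch_succ_left, sub_add_cancel, Nat.cast_succ, sub_add_eq_sub_sub]
        ring
      have key := polySum_step_back n t
      have q1 : t + n ≠ 0 := by positivity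
      have r1 : t + 2 * n + 1 ≠ 0 := by positivity
      have r2 : t + 2 * n + 2 ≠ 0 := by positivity
      have hs : certLead (n + 1) t = poch (t - n - 1) n
          * ((t - n - 2) * (4 * stepD n * (t + n) * polySum (n + 1) t))
          / (4 * stepD n * (t + n) * (t + 2 * n + 1) * poch t (2 * n + 1)) := by
        rw [certLead, hd1, hw]
        push_cast
        rw [show t + 2 * ((n : ℝ) + 1) = t + 2 * n + 2 by ring]
        field_simp
      rw [hs, key]
      simp only [hE, certLead]
      field_simp
    have := (ih.neg.add (hasDerivAt_sub_one_sq_mul hE1))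
    rw [neg_zero, add_zero] at this
    exact this.congr_of_eventuallyEq hU

theorem contDiffAt_certLead (n : ℕ) : ContDiffAt ℝ 2 (certLead n) 1 := by
  unfold certLead
  refine ContDiffAt.fun_div ?_ (contDiff_poch _).contDiffAt (poch_pos one_pos _).ne'
  have h4 : ContDiff ℝ 2 fun t : ℝ => poch (t - n - 1) n :=
    (contDiff_poch n).comp (f := fun t : ℝ => t - n - 1) (by fun_prop)
  have h3 := contDiff_polySum n
  fun_prop

theorem deriv_deriv_cert_one (n : ℕ) : deriv (deriv (cert n)) 1 = 0 := by
  set g : ℝ → ℝ := fun t => poch (t - n - 1) n * ((lead n * t ^ 5 + rhoLow n t) * polySum n t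
      - beta1 n t * (t + 3 * n) * polySum n (t - 1))
      / (4 * stepD n * (t + n) * (t + n + 1) * poch t (2 * n + 4)) with hg
  have hD : stepD n ≠ 0 := by unfold stepD; positivity
  have hg1 : ContDiffAt ℝ 2 g 1 := by
    have h2 := contDiff_poch (2 * n + 4)
    have h3 := contDiff_polySum n
    have h4 : ContDiff ℝ 2 fun t : ℝ => poch (t - n - 1) n :=
      (contDiff_poch n).comp (f := fun t : ℝ => t - n - 1) (by fun_prop)
    refine ContDiffAt.fun_div ?_ ?_ ?_
    · unfold rhoLow beta1 betaLow
      fun_prop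
    · fun_prop
    · have := (poch_pos one_pos (2 * n + 4)).ne'
      positivity
  refine deriv_deriv_eq_zero_of_eventuallyEq_mul
    (u := fun t => kap n / 4 * certLead n t + (t - 1) ^ 2 * g t) ?_ ?_ ?_
  · filter_upwards [lt_mem_nhds (zero_lt_one : (0 : ℝ) < 1)] with t ht
    have hL := (poch_pos ht (2 * n + 1)).ne'
    have hd3 : poch t (2 * n + 4)
        = poch t (2 * n + 1) * (t + 2 * n + 1) * (t + 2 * n + 2) * (t + 2 * n + 3) := by
      rw [show 2 * n + 4 = 2 * n + 1 + 1 + 1 + 1 by ring, poch_succ, poch_succ, poch_succ]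
      push_cast; ring
    have hw : poch (t - n - 1) (n + 1) = poch (t - n - 1) n * (t - 1) := by
      rw [poch_succ]; ring
    have hA := polySum_shift_back n t
    have hb : beta0 n t * polySum n t + t ^ 2 * (t + n) * beta1 n t * polySum n (t + 1)
        = stepD n * kap n * ((t + 2 * n) * (t + n) * (t + n + 1) * (t + 2 * n + 1)
          * (t + 2 * n + 2) * (t + 2 * n + 3)) * polySum n t
          + (t - 1) ^ 2 * ((lead n * t ^ 5 + rhoLow n t) * polySum n t
            - beta1 n t * (t + 3 * n) * polySum n (t - 1)) := by
      unfold beta0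
      linear_combination beta1 n t * hA
    rw [cert, hb, hw]
    simp only [hg, certLead]
    rw [hd3]
    have q1 : t + n ≠ 0 := by positivity
    have q2 : t + n + 1 ≠ 0 := by positivity
    have r1 : t + 2 * n + 1 ≠ 0 := by positivity
    have r2 : t + 2 * n + 2 ≠ 0 := by positivity
    have r3 : t + 2 * n + 3 ≠ 0 := by positivity
    field_simp
  · have := contDiffAt_certLead n
    fun_prop
  · have := ((hasDerivAt_certLead n).const_mul (kap n / 4)).fun_add
      (hasDerivAt_sub_one_sq_mul (hg1.differentiableAt (by simp)))
    simpa using this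

/-- `f` agrees on the positive reals with a rational function without positive poles, whose degree
at infinity is at most `k`. -/
def IsRatOfOrder (f : ℝ → ℝ) (k : ℤ) : Prop :=
  ∃ P Q : Polynomial ℝ, (∀ t : ℝ, 0 < t → Q.eval t ≠ 0) ∧
    (∀ t : ℝ, 0 < t → f t = P.eval t / Q.eval t) ∧ (P.natDegree : ℤ) ≤ Q.natDegree + k

namespace IsRatOfOrder

variable {f g : ℝ → ℝ} {k l : ℤ}

theorem congr (hf : IsRatOfOrder f k) (h : ∀ t, 0 < t → g t = f t) : IsRatOfOrder g k := by
  obtain ⟨P, Q, h1, h2, h3⟩ := hf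
  exact ⟨P, Q, h1, fun t ht => (h t ht).trans (h2 t ht), h3⟩

theorem mono (hf : IsRatOfOrder f k) (h : k ≤ l) : IsRatOfOrder f l := by
  obtain ⟨P, Q, h1, h2, h3⟩ := hf
  exact ⟨P, Q, h1, h2, by lia⟩

theorem of_eval (P : Polynomial ℝ) (h : (P.natDegree : ℤ) ≤ k) :
    IsRatOfOrder (fun t => P.eval t) k :=
  ⟨P, 1, by simp, by simp, by simpa using h⟩

theorem zero (k : ℤ) : IsRatOfOrder (fun _ => 0) k :=
  ⟨0, Polynomial.X ^ k.natAbs, fun t ht => by simpa using fun h => absurd h ht.ne', by simp,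
    by simp only [Polynomial.natDegree_zero, Polynomial.natDegree_X_pow]; lia⟩

theorem const (c : ℝ) : IsRatOfOrder (fun _ => c) 0 :=
  (of_eval (Polynomial.C c) (by simp)).congr (by simp)

theorem cubic (a b c d : ℝ) : IsRatOfOrder (fun t => a * t ^ 3 + b * t ^ 2 + c * t + d) 3 := by
  open Polynomial in
  refine (of_eval (C a * X ^ 3 + C b * X ^ 2 + C c * X + C d) ?_).congr (by simp)
  exact_mod_cast natDegree_cubic_le

theorem quadratic (a b c : ℝ) : IsRatOfOrder (fun t => a * t ^ 2 + b * t + c) 2 := by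
  open Polynomial in
  refine (of_eval (C a * X ^ 2 + C b * X + C c) ?_).congr (by simp)
  exact_mod_cast natDegree_quadratic_le

theorem add_const (c : ℝ) : IsRatOfOrder (fun t => t + c) 1 := by
  open Polynomial in
  refine (of_eval (X + C c) ?_).congr (by simp)
  simp

theorem mul (hf : IsRatOfOrder f k) (hg : IsRatOfOrder g l) :
    IsRatOfOrder (fun t => f t * g t) (k + l) := by
  obtain ⟨P, Q, h1, h2, h3⟩ := hf
  obtain ⟨P', Q', h1', h2', h3'⟩ := hg
  have hQ : Q ≠ 0 := fun h => h1 1 one_pos (by simp [h])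
  have hQ' : Q' ≠ 0 := fun h => h1' 1 one_pos (by simp [h])
  refine ⟨P * P', Q * Q', fun t ht => ?_, fun t ht => ?_, ?_⟩
  · simpa using ⟨h1 t ht, h1' t ht⟩
  · simp only [h2 t ht, h2' t ht]
    rw [Polynomial.eval_mul, Polynomial.eval_mul, div_mul_div_comm]
  · rw [Polynomial.natDegree_mul hQ hQ']
    have := Polynomial.natDegree_mul_le (p := P) (q := P')
    push_cast
    lia

theorem add (hf : IsRatOfOrder f k) (hg : IsRatOfOrder g k) :
    IsRatOfOrder (fun t => f t + g t) k := by
  obtain ⟨P, Q, h1, h2, h3⟩ := hf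
  obtain ⟨P', Q', h1', h2', h3'⟩ := hg
  have hQ : Q ≠ 0 := fun h => h1 1 one_pos (by simp [h])
  have hQ' : Q' ≠ 0 := fun h => h1' 1 one_pos (by simp [h])
  refine ⟨P * Q' + Q * P', Q * Q', fun t ht => ?_, fun t ht => ?_, ?_⟩
  · simpa using ⟨h1 t ht, h1' t ht⟩
  · simp only [h2 t ht, h2' t ht]
    rw [Polynomial.eval_add, Polynomial.eval_mul, Polynomial.eval_mul, Polynomial.eval_mul,
      div_add_div _ _ (h1 t ht) (h1' t ht)]
  · rw [Polynomial.natDegree_mul hQ hQ']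
    have e1 := Polynomial.natDegree_mul_le (p := P) (q := Q')
    have e2 := Polynomial.natDegree_mul_le (p := Q) (q := P')
    have e3 := Polynomial.natDegree_add_le (P * Q') (Q * P')
    push_cast
    lia

theorem quartic (a b c d e : ℝ) :
    IsRatOfOrder (fun t => a * t ^ 4 + b * t ^ 3 + c * t ^ 2 + d * t + e) 4 :=
  ((((cubic a b c d).mul (add_const 0)).mono (l := 4) (by norm_num)).add
    ((const e).mono (by norm_num))).congr fun t _ => by ring

theorem const_mul (c : ℝ) (hf : IsRatOfOrder f k) : IsRatOfOrder (fun t => c * f t) k := by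
  simpa using (const c).mul hf

theorem sum {ι : Type*} (s : Finset ι) {F : ι → ℝ → ℝ} (h : ∀ i ∈ s, IsRatOfOrder (F i) k) :
    IsRatOfOrder (fun t => ∑ i ∈ s, F i t) k := by
  classical
  induction s using Finset.induction_on with
  | empty => simpa using zero k
  | insert a s ha ih =>
    simp only [Finset.sum_insert ha]
    exact (h a (by simp)).add (ih fun i hi => h i (by simp [hi]))

theorem inv_add_const {c : ℝ} (hc : 0 ≤ c) : IsRatOfOrder (fun t => (t + c)⁻¹) (-1) := by
  open Polynomial in
  refine ⟨1, X + C c, fun t ht => ?_, by simp, by simp⟩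
  simp only [eval_add, eval_X, eval_C]
  positivity

theorem differentiableAt (hf : IsRatOfOrder f k) {t : ℝ} (ht : 0 < t) :
    DifferentiableAt ℝ f t := by
  obtain ⟨P, Q, h1, h2, -⟩ := hf
  refine (P.differentiableAt.fun_div Q.differentiableAt (h1 t ht)).congr_of_eventuallyEq ?_
  filter_upwards [lt_mem_nhds ht] with x hx using h2 x hx

theorem deriv (hf : IsRatOfOrder f k) : IsRatOfOrder (deriv f) (k - 1) := by
  obtain ⟨P, Q, h1, h2, h3⟩ := hf
  have hQ : Q ≠ 0 := fun h => h1 1 one_pos (by simp [h])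
  have hd : ∀ t, 0 < t → _root_.deriv f t
      = (P.derivative * Q - P * Q.derivative).eval t / (Q ^ 2).eval t := by
    intro t ht
    have : f =ᶠ[nhds t] fun x => P.eval x / Q.eval x := by
      filter_upwards [lt_mem_nhds ht] with x hx using h2 x hx
    rw [this.deriv_eq, ((P.hasDerivAt t).fun_div (Q.hasDerivAt t) (h1 t ht)).deriv]
    simp
  by_cases h0 : P.natDegree + Q.natDegree = 0
  · have hP0 : P.derivative = 0 := Polynomial.derivative_of_natDegree_zero (by lia)
    have hQ0 : Q.derivative = 0 := Polynomial.derivative_of_natDegree_zero (by lia)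
    exact (zero (k - 1)).congr fun t ht => by simp [hd t ht, hP0, hQ0]
  · refine ⟨P.derivative * Q - P * Q.derivative, Q ^ 2, fun t ht => ?_, hd, ?_⟩
    · simpa using h1 t ht
    · have e : ((P.derivative * Q - P * Q.derivative).natDegree : ℤ)
          ≤ P.natDegree + Q.natDegree - 1 := by
        have e1 : (P.derivative * Q).natDegree + 1 ≤ P.natDegree + Q.natDegree := by
          by_cases hP : P.natDegree = 0
          · rw [Polynomial.derivative_of_natDegree_zero hP]; simp; lia
          · have := Polynomial.natDegree_mul_le (p := P.derivative) (q := Q)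
            have := Polynomial.natDegree_derivative_le P
            lia
        have e2 : (P * Q.derivative).natDegree + 1 ≤ P.natDegree + Q.natDegree := by
          by_cases hP : Q.natDegree = 0
          · rw [Polynomial.derivative_of_natDegree_zero hP]; simp; lia
          · have := Polynomial.natDegree_mul_le (p := P) (q := Q.derivative)
            have := Polynomial.natDegree_derivative_le Q
            lia
        have e3 := Polynomial.natDegree_sub_le (P.derivative * Q) (P * Q.derivative)
        lia
      rw [Polynomial.natDegree_pow]
      push_cast
      lia

theorem tendsto_zero (hf : IsRatOfOrder f k) (hk : k ≤ -1) :
    Filter.Tendsto f Filter.atTop (nhds 0) := by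
  obtain ⟨P, Q, -, h2, h3⟩ := hf
  have hlt : P.degree < Q.degree := Polynomial.degree_lt_degree (by lia)
  refine (Polynomial.div_tendsto_atTop_zero_of_degree_lt P Q hlt).congr' ?_
  filter_upwards [Filter.eventually_gt_atTop 0] with x hx using (h2 x hx).symm

theorem summable (hf : IsRatOfOrder f k) (hk : k ≤ -2) :
    Summable fun ν : ℕ => f (1 + (ν : ℝ)) := by
  have hb : (fun t => t ^ 2 * f t) =O[Filter.atTop] fun _ => (1 : ℝ) := by
    have hp : IsRatOfOrder (fun t => t ^ 2 * f t) 0 :=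
      (((quadratic 1 0 0).mul hf).mono (by lia)).congr fun t _ => by ring
    obtain ⟨P, Q, h1, h2, h3⟩ := hp
    have hQ : Q ≠ 0 := fun h => h1 1 one_pos (by simp [h])
    have hle : P.degree ≤ Q.degree := by
      rw [Polynomial.degree_eq_natDegree hQ]
      exact Polynomial.degree_le_of_natDegree_le (by lia)
    have hO := (Polynomial.isBigO_atTop_of_degree_le P Q hle).mul
      (Asymptotics.isBigO_refl (fun t => (Q.eval t)⁻¹) Filter.atTop)
    refine hO.congr' ?_ ?_
    · filter_upwards [Filter.eventually_gt_atTop 0] with x hx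
      exact (div_eq_mul_inv _ _).symm.trans (h2 x hx).symm
    · filter_upwards [Filter.eventually_gt_atTop 0] with x hx
      exact mul_inv_cancel₀ (h1 x hx)
  have hb2 : f =O[Filter.atTop] fun t => (t ^ 2)⁻¹ := by
    refine ((Asymptotics.isBigO_refl (fun t : ℝ => (t ^ 2)⁻¹) Filter.atTop).mul hb).congr' ?_ ?_
    · filter_upwards [Filter.eventually_gt_atTop 0] with x hx
      field_simp
    · simp
  have ht : Filter.Tendsto (fun ν : ℕ => 1 + (ν : ℝ)) Filter.atTop Filter.atTop :=
    Filter.tendsto_atTop_add_const_left _ _ tendsto_natCast_atTop_atTop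
  refine summable_of_isBigO_nat ?_ (hb2.comp_tendsto ht)
  have h := (summable_nat_add_iff 1).2 (Real.summable_nat_pow_inv.2 one_lt_two)
  refine h.congr fun ν => ?_
  simp [add_comm]

end IsRatOfOrder

theorem isRatOfOrder_poch_add (c : ℝ) (n : ℕ) : IsRatOfOrder (fun t => poch (t + c) n) n := by
  induction n with
  | zero => exact (IsRatOfOrder.const 1).congr fun t _ => by simp [poch]
  | succ n ih =>
    refine ((ih.mul (IsRatOfOrder.add_const (c + n))).mono (by push_cast; lia)).congr fun t _ => ?_
    rw [poch_succ]; ring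

theorem isRatOfOrder_inv_poch (n : ℕ) : IsRatOfOrder (fun t => (poch t n)⁻¹) (-n) := by
  induction n with
  | zero => exact (IsRatOfOrder.const 1).congr fun t _ => by simp [poch]
  | succ n ih =>
    refine ((ih.mul (IsRatOfOrder.inv_add_const n.cast_nonneg)).mono (by push_cast; lia)).congr
      fun t _ => ?_
    rw [poch_succ, mul_inv]

theorem isRatOfOrder_polySum (n : ℕ) : IsRatOfOrder (polySum n) n := by
  unfold polySum
  refine IsRatOfOrder.sum _ fun j _ => IsRatOfOrder.const_mul _ ?_
  simpa only [sub_eq_add_neg] using isRatOfOrder_poch_add (-j) n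

theorem isRatOfOrder_polySum_sub (n : ℕ) :
    IsRatOfOrder (fun t => polySum n (t + 1) - polySum n t) (n - 1) := by
  have h : ∀ j ∈ Finset.range (n + 1), IsRatOfOrder
      (fun t => polyWeight n j * (poch (t + 1 - j) n - poch (t - j) n)) (n - 1) := by
    intro j _
    refine IsRatOfOrder.const_mul _ ?_
    cases n with
    | zero => exact (IsRatOfOrder.zero _).congr fun t _ => by simp [poch]
    | succ n =>
      refine (((isRatOfOrder_poch_add (1 - j) n).const_mul (n + 1)).mono (by push_cast; lia)).congr
        fun t _ => ?_
      rw [poch_succ_left (t - j), poch_succ, show t - j + 1 = t + 1 - j by ring,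
        show t + (1 - (j : ℝ)) = t + 1 - j by ring]
      ring
  refine (IsRatOfOrder.sum _ h).congr fun t _ => ?_
  simp only [polySum, mul_sub, Finset.sum_sub_distrib]

theorem isRatOfOrder_Rtilde_zero (n : ℕ) : IsRatOfOrder (Rtilde n 0) (-2) := by
  have h1 := isRatOfOrder_poch_add (-n) n
  have h2 := IsRatOfOrder.inv_add_const (c := n) n.cast_nonneg
  refine ((((h1.mul (isRatOfOrder_polySum n)).mul h2).mul
    (isRatOfOrder_inv_poch (2 * n + 1))).mono (by push_cast; lia)).congr fun t ht => ?_
  rw [Rtilde_zero_eq n ht, div_eq_mul_inv, mul_inv, sub_eq_add_neg]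
  ring

theorem isRatOfOrder_beta1 (n : ℝ) : IsRatOfOrder (beta1 n) 4 := by
  have h1 := ((IsRatOfOrder.quadratic 1 0 0).mul (IsRatOfOrder.quadratic 1 0 0)).const_mul (lead n)
  have h2 : IsRatOfOrder (betaLow n) 3 := by
    unfold betaLow
    exact IsRatOfOrder.cubic _ _ _ _
  exact (h1.add (h2.mono (by norm_num))).congr fun t _ => by unfold beta1; ring

theorem isRatOfOrder_beta0_add (n : ℝ) :
    IsRatOfOrder (fun t => beta0 n t + t ^ 2 * (t + n) * beta1 n t) 6 := by
  have h2 : IsRatOfOrder (betaLow n) 3 := by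
    unfold betaLow
    exact IsRatOfOrder.cubic _ _ _ _
  have h3 : IsRatOfOrder (rhoLow n) 4 := by
    unfold rhoLow
    exact IsRatOfOrder.quartic _ _ _ _ _
  have e1 := (((IsRatOfOrder.quadratic 1 0 0).mul (IsRatOfOrder.quadratic 1 0 0)).mul
    (IsRatOfOrder.quadratic (-3 * n) (n ^ 2 + 5 * n)
      (-2 * n ^ 3 - 3 * n ^ 2 - 3 * n))).const_mul (lead n)
  have e2 := h2.mul (IsRatOfOrder.cubic (-1) (2 - 3 * n) (n ^ 2 + 5 * n - 1)
    (-2 * n ^ 3 - 3 * n ^ 2 - 3 * n))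
  have e3 := ((((((IsRatOfOrder.add_const (2 * n)).mul (IsRatOfOrder.add_const n)).mul
    (IsRatOfOrder.add_const (n + 1))).mul (IsRatOfOrder.add_const (2 * n + 1))).mul
    (IsRatOfOrder.add_const (2 * n + 2))).mul (IsRatOfOrder.add_const (2 * n + 3))).const_mul
    (stepD n * kap n)
  have e4 := (IsRatOfOrder.quadratic 1 (-2) 1).mul h3
  refine ((e1.mono (by norm_num)).add ((e2.mono (by norm_num)).add
    ((e3.mono (by norm_num)).add (e4.mono (by norm_num))))).congr fun t _ => ?_
  unfold beta0 beta1 shiftA1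
  ring

theorem isRatOfOrder_cert (n : ℕ) : IsRatOfOrder (cert n) 1 := by
  have h1 := (isRatOfOrder_beta0_add n).mul (isRatOfOrder_polySum n)
  have h2 := ((IsRatOfOrder.cubic 1 n 0 0).mul (isRatOfOrder_beta1 n)).mul
    (isRatOfOrder_polySum_sub n)
  have h3 := (h1.mono (l := n + 6) (by lia)).add (h2.mono (l := n + 6) (by lia))
  have w := isRatOfOrder_poch_add (-n - 1) (n + 1)
  have d1 := IsRatOfOrder.inv_add_const (c := n) n.cast_nonneg
  have d2 := IsRatOfOrder.inv_add_const (c := n + 1) (by positivity)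
  refine (((((w.mul h3).mul d1).mul d2).mul
    (isRatOfOrder_inv_poch (2 * n + 4))).const_mul (4 * stepD n)⁻¹ |>.mono
      (by push_cast; lia)).congr fun t _ => ?_
  rw [cert, div_eq_mul_inv, mul_inv, mul_inv, mul_inv, show t + (-n - 1) = t - (n : ℝ) - 1 by ring,
    show t + ((n : ℝ) + 1) = t + n + 1 by ring]
  ring

theorem deriv_comb_eq_sub {f₀ f₁ f₂ g : ℝ → ℝ} {a b c : ℝ}
    (h₀ : ∀ t, 0 < t → DifferentiableAt ℝ f₀ t) (h₁ : ∀ t, 0 < t → DifferentiableAt ℝ f₁ t)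
    (h₂ : ∀ t, 0 < t → DifferentiableAt ℝ f₂ t) (hg : ∀ t, 0 < t → DifferentiableAt ℝ g t)
    (h : ∀ t, 0 < t → a * f₀ t + b * f₁ t + c * f₂ t = g (t + 1) - g t) (t : ℝ) (ht : 0 < t) :
    a * deriv f₀ t + b * deriv f₁ t + c * deriv f₂ t = deriv g (t + 1) - deriv g t := by
  have e1 := (((h₀ t ht).hasDerivAt.const_mul a).add ((h₁ t ht).hasDerivAt.const_mul b)).add
    ((h₂ t ht).hasDerivAt.const_mul c)
  have e2 := ((hg (t + 1) (by positivity)).hasDerivAt.comp_add_const t 1).sub (hg t ht).hasDerivAt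
  refine e1.unique (e2.congr_of_eventuallyEq ?_)
  filter_upwards [lt_mem_nhds ht] with x hx using h x hx

/-- The second-order recurrence in `n` satisfied by `Z_r(n,0)`. -/
theorem Zr_n_zero_recurrence (n : ℕ) :
    16 * ((n : ℝ) + 1) ^ 3 * (2 * (n : ℝ) + 1) ^ 4 * (4 * (n : ℝ) + 3) * (4 * (n : ℝ) + 5) *
        (5460 * (n : ℝ) ^ 4 + 35339 * (n : ℝ) ^ 3 + 85858 * (n : ℝ) ^ 2
          + 92804 * (n : ℝ) + 37656) * Zr n 0
      + (357913920 * (n : ℝ) ^ 13 + 5716680688 * (n : ℝ) ^ 12 + 41762423804 * (n : ℝ) ^ 11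
          + 184637211081 * (n : ℝ) ^ 10 + 550778114541 * (n : ℝ) ^ 9
          + 1169740743051 * (n : ℝ) ^ 8 + 1818232366245 * (n : ℝ) ^ 7
          + 2092705983417 * (n : ℝ) ^ 6 + 1782121652067 * (n : ℝ) ^ 5
          + 1108272850929 * (n : ℝ) ^ 4 + 488951050619 * (n : ℝ) ^ 3
          + 144869028586 * (n : ℝ) ^ 2 + 25833166356 * (n : ℝ) + 2094206184) * Zr (n + 1) 0
      + 8 * ((n : ℝ) + 2) ^ 4 * (2 * (n : ℝ) + 3) ^ 5 *
          (5460 * (n : ℝ) ^ 4 + 13499 * (n : ℝ) ^ 3 + 12601 * (n : ℝ) ^ 2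
            + 5265 * (n : ℝ) + 831) * Zr (n + 2) 0 = 0 := by
  have r₀ := isRatOfOrder_Rtilde_zero n
  have r₁ := isRatOfOrder_Rtilde_zero (n + 1)
  have r₂ := isRatOfOrder_Rtilde_zero (n + 2)
  have rc := isRatOfOrder_cert n
  have h1 := deriv_comb_eq_sub (fun _ => r₀.differentiableAt) (fun _ => r₁.differentiableAt)
    (fun _ => r₂.differentiableAt) (fun _ => rc.differentiableAt)
    fun _ ht => Rtilde_telescope n ht
  have h2 := deriv_comb_eq_sub (fun _ => r₀.deriv.differentiableAt)
    (fun _ => r₁.deriv.differentiableAt) (fun _ => r₂.deriv.differentiableAt)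
    (fun _ => rc.deriv.differentiableAt) h1
  have s := (((r₀.deriv.deriv.summable (by norm_num)).hasSum.mul_left (recC0 n)).add
    ((r₁.deriv.deriv.summable (by norm_num)).hasSum.mul_left (recC1 n))).add
    ((r₂.deriv.deriv.summable (by norm_num)).hasSum.mul_left (recC2 n))
  have s' := s.tendsto_sum_nat
  have hpart : ∀ N : ℕ, ∑ ν ∈ Finset.range N,
      (recC0 n * deriv (deriv (Rtilde n 0)) (1 + (ν : ℝ))
        + recC1 n * deriv (deriv (Rtilde (n + 1) 0)) (1 + (ν : ℝ))
        + recC2 n * deriv (deriv (Rtilde (n + 2) 0)) (1 + (ν : ℝ)))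
      = deriv (deriv (cert n)) (1 + (N : ℝ)) := by
    intro N
    rw [Finset.sum_congr rfl fun (ν : ℕ) _ => h2 (1 + (ν : ℝ)) (by positivity)]
    have := Finset.sum_range_sub (fun ν : ℕ => deriv (deriv (cert n)) (1 + (ν : ℝ))) N
    simp only [Nat.cast_zero, add_zero, deriv_deriv_cert_one, sub_zero, Nat.cast_succ] at this
    rw [← this]
    simp only [add_assoc]
  simp only [hpart] at s'
  have ht : Filter.Tendsto (fun N : ℕ => 1 + (N : ℝ)) Filter.atTop Filter.atTop :=
    Filter.tendsto_atTop_add_const_left _ _ tendsto_natCast_atTop_atTop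
  have hz := tendsto_nhds_unique s' ((rc.deriv.deriv.tendsto_zero (by norm_num)).comp ht)
  unfold recC0 recC1 recC2 at hz
  unfold Zr
  linear_combination hz / 6
end

section
/- For all integers n ≥ 3 and m with 0 ≤ m ≤ n-2, the identity Σ_{i=1}^{n-3} ((-1)^i/i)·C(n,i)·C(2n-m+i, n) = ((-1)^n C(3n-m-2, n-2) / (2(n-2)(n-1)²n²))·(-4m - 4m² + 12n + 30mn + 6m²n - 54n² - 43mn² - 7m²n² + 70n³ + 40mn³ + 4m²n³ - 54n⁴ - 19mn⁴ - m²n⁴ + 22n⁵ + 4mn⁵ - 4n⁶) - C(2n-m, n)·(S₁(2n-m) + S₁(n) - S₁(n-m)) holds, where S₁(N) = Σ_{i=1}^N 1/i. -/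
open scoped BigOperators

open Finset Polynomial in
/-- A polynomial of degree less than `n` is annihilated by the `n`-th alternating binomial sum. -/
theorem alternating_sum_choose_mul_eval_eq_zero (n : ℕ) (P : ℝ[X]) (hP : P.natDegree < n) :
    ∑ k ∈ range (n + 1), (-1 : ℝ) ^ k * (n.choose k : ℝ) * P.eval (k : ℝ) = 0 := by
  have h := congrFun (fwdDiff_iter_eq_zero_of_degree_lt hP) 0
  rw [fwdDiff_iter_eq_sum_shift] at h
  simp only [zero_add, nsmul_eq_mul, mul_one, zsmul_eq_mul, Pi.zero_apply] at h
  push_cast at h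
  rw [← mul_zero ((-1 : ℝ) ^ n), ← h, mul_sum]
  refine sum_congr rfl fun k hk => ?_
  obtain ⟨d, rfl⟩ := Nat.exists_eq_add_of_le (Nat.lt_succ_iff.mp (mem_range.mp hk))
  have hd : (-1 : ℝ) ^ d * (-1) ^ d = 1 := by rw [← mul_pow]; norm_num
  rw [Nat.add_sub_cancel_left, pow_add]
  linear_combination (-(-1 : ℝ) ^ k * ((k + d).choose k : ℝ) * P.eval (k : ℝ)) * hd

open Finset in
theorem alternating_sum_choose_div (n : ℕ) :
    ∑ k ∈ range n, (-1 : ℝ) ^ (k + 1) / (k + 1) * (n.choose (k + 1) : ℝ) = -S1 n := by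
  induction n with
  | zero => simp [S1]
  | succ n ih =>
    have halt : ∑ k ∈ range (n + 1), (-1 : ℝ) ^ (k + 1) * ((n + 1).choose (k + 1) : ℝ) = -1 := by
      have h := Int.alternating_sum_range_choose_of_ne n.succ_ne_zero
      rw [Nat.succ_eq_add_one, sum_range_succ'] at h
      have h' : ((∑ k ∈ range (n + 1), (-1) ^ (k + 1) * ((n + 1).choose (k + 1) : ℤ) : ℤ) : ℝ)
          = -1 := by
        rw [eq_neg_of_add_eq_zero_left h]; simp
      push_cast at h'
      exact h'
    have hext : ∑ k ∈ range (n + 1), (-1 : ℝ) ^ (k + 1) / (k + 1) * (n.choose (k + 1) : ℝ)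
        = -S1 n := by
      rw [sum_range_succ, ih]; simp
    have hS : S1 (n + 1) = S1 n + 1 / (n + 1) := by simp [S1, sum_range_succ]
    have hn : (n : ℝ) + 1 ≠ 0 := by positivity
    have hdiv : -(1 / ((n : ℝ) + 1)) =
        (∑ k ∈ range (n + 1), (-1 : ℝ) ^ (k + 1) * ((n + 1).choose (k + 1) : ℝ)) / (n + 1) := by
      rw [halt, neg_div]
    rw [hS, neg_add, ← hext, hdiv, sum_div, ← sum_add_distrib]
    refine sum_congr rfl fun k _ => ?_
    have hk : (k : ℝ) + 1 ≠ 0 := by positivity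
    have habs : ((n : ℝ) + 1) * n.choose k = (n + 1).choose (k + 1) * (k + 1) := by
      exact_mod_cast Nat.add_one_mul_choose_eq n k
    have hpas : ((n + 1).choose (k + 1) : ℝ) = n.choose k + n.choose (k + 1) := by
      exact_mod_cast Nat.choose_succ_succ n k
    have hcancel : ((n + 1).choose (k + 1) : ℝ) / (n + 1) = n.choose k / (k + 1) := by
      rw [div_eq_div_iff hn hk, ← habs]; ring
    rw [mul_div_assoc, hcancel, hpas]
    ring

open Finset Polynomial in
/-- The alternating sum with weights `1 / k` extracts the two lowest coefficients of a polynomial. -/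
theorem alternating_sum_choose_div_mul_eval (n : ℕ) (hn : 0 < n) (P : ℝ[X])
    (hP : P.natDegree ≤ n) :
    ∑ k ∈ range n, (-1 : ℝ) ^ (k + 1) / (k + 1) * (n.choose (k + 1) : ℝ) * P.eval ((k : ℝ) + 1)
      = -P.coeff 1 - P.coeff 0 * S1 n := by
  have h := alternating_sum_choose_mul_eval_eq_zero n P.divX
    (by rw [natDegree_divX_eq_natDegree_tsub_one]; omega)
  rw [sum_range_succ'] at h
  simp only [pow_zero, Nat.choose_zero_right, Nat.cast_one, Nat.cast_zero, one_mul,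
    ← coeff_zero_eq_eval_zero, coeff_divX, zero_add] at h
  rw [← eq_neg_iff_add_eq_zero] at h
  rw [← h, sub_eq_add_neg, ← mul_neg, ← alternating_sum_choose_div, mul_sum, ← sum_add_distrib]
  refine sum_congr rfl fun k _ => ?_
  have hk : (k : ℝ) + 1 ≠ 0 := by positivity
  have he : P.eval ((k : ℝ) + 1) = P.divX.eval ((k : ℝ) + 1) * (k + 1) + P.coeff 0 := by
    conv_lhs => rw [← divX_mul_X_add P]
    simp
  rw [he]
  push_cast
  field_simp

open Finset Polynomial in
theorem alternating_sum_choose_div_mul_choose (M n : ℕ) (hn : 0 < n) :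
    ∑ k ∈ range n, (-1 : ℝ) ^ (k + 1) / (k + 1) * (n.choose (k + 1) : ℝ) *
        ((M + n + (k + 1)).choose n : ℝ)
      = -((M + n).choose n : ℝ) * (S1 (M + n) + S1 n - S1 M) := by
  set P : ℕ → ℝ[X] := fun r => ∏ j ∈ range r, (X + C ((M : ℝ) + j + 1)) with hPdef
  have hdeg : (P n).natDegree ≤ n := by
    refine (natDegree_prod_le _ _).trans ?_
    simp only [natDegree_X_add_C, sum_const, card_range, smul_eq_mul, mul_one, le_refl]
  have heval (i : ℕ) : (P n).eval (i : ℝ) = n.factorial * ((M + n + i).choose n : ℝ) := by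
    have h := Nat.ascFactorial_eq_factorial_mul_choose (M + i) n
    rw [Nat.ascFactorial_eq_prod_range] at h
    rw [show M + n + i = M + i + n by ring, ← Nat.cast_mul, ← h, hPdef, eval_prod]
    push_cast
    refine prod_congr rfl fun j _ => ?_
    simp only [eval_add, eval_X, eval_C]
    ring
  have hcoeff : ∀ r, (P r).coeff 1 = (P r).coeff 0 * (S1 (M + r) - S1 M) := by
    intro r
    induction r with
    | zero => simp [hPdef, coeff_one]
    | succ r ih =>
      have hs : P (r + 1) = P r * (X + C ((M : ℝ) + r + 1)) := prod_range_succ _ _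
      have hS : S1 (M + (r + 1)) = S1 (M + r) + 1 / ((M : ℝ) + r + 1) := by
        rw [← add_assoc]; simp [S1, sum_range_succ]
      have hpos : (M : ℝ) + r + 1 ≠ 0 := by positivity
      rw [hs, mul_coeff_one, mul_coeff_zero, ih, hS]
      simp only [coeff_add, coeff_X_zero, coeff_C_zero, coeff_X_one, coeff_C_succ]
      field_simp
      ring
  have h0 : (P n).coeff 0 = n.factorial * ((M + n).choose n : ℝ) := by
    rw [coeff_zero_eq_eval_zero]
    simpa using heval 0
  have h := alternating_sum_choose_div_mul_eval n hn (P n) hdeg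
  rw [hcoeff, h0] at h
  have hf : (n.factorial : ℝ) ≠ 0 := by positivity
  apply mul_left_cancel₀ hf
  rw [mul_sum]
  calc _ = _ := by
        refine sum_congr rfl fun k _ => ?_
        have := heval (k + 1)
        push_cast at this
        rw [this]
        ring
    _ = _ := h
    _ = _ := by ring

/-- The binomial-sum evaluation used in the proof: for `n ≥ 3` and `0 ≤ m ≤ n - 2`,
`Σ_{i=1}^{n-3} ((-1)^i/i) C(n,i) C(2n-m+i,n)` has the stated closed form. -/
theorem binomial_sum_eval (n m : ℕ) (hn : 3 ≤ n) (hm : m + 2 ≤ n) :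
    ∑ i ∈ Finset.Icc 1 (n - 3),
        (-1 : ℝ) ^ i / i * (n.choose i : ℝ) * ((2 * n - m + i).choose n : ℝ) =
      (-1 : ℝ) ^ n * ((3 * n - m - 2).choose (n - 2) : ℝ) /
          (2 * ((n : ℝ) - 2) * ((n : ℝ) - 1) ^ 2 * (n : ℝ) ^ 2) *
        (-4 * (m : ℝ) - 4 * (m : ℝ) ^ 2 + 12 * (n : ℝ) + 30 * (m : ℝ) * n
          + 6 * (m : ℝ) ^ 2 * n - 54 * (n : ℝ) ^ 2 - 43 * (m : ℝ) * (n : ℝ) ^ 2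
          - 7 * (m : ℝ) ^ 2 * (n : ℝ) ^ 2 + 70 * (n : ℝ) ^ 3 + 40 * (m : ℝ) * (n : ℝ) ^ 3
          + 4 * (m : ℝ) ^ 2 * (n : ℝ) ^ 3 - 54 * (n : ℝ) ^ 4 - 19 * (m : ℝ) * (n : ℝ) ^ 4
          - (m : ℝ) ^ 2 * (n : ℝ) ^ 4 + 22 * (n : ℝ) ^ 5 + 4 * (m : ℝ) * (n : ℝ) ^ 5
          - 4 * (n : ℝ) ^ 6)
      - ((2 * n - m).choose n : ℝ) * (S1 (2 * n - m) + S1 n - S1 (n - m)) := by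
  obtain ⟨d, rfl⟩ := Nat.exists_eq_add_of_le hm
  obtain ⟨a, ha⟩ : ∃ a, m + d = a + 1 := ⟨m + d - 1, by omega⟩
  have hn' : m + 2 + d = a + 3 := by omega
  have hfull := alternating_sum_choose_div_mul_choose (d + 2) (a + 3) (by omega)
  have hN : d + 2 + (a + 3) = 2 * (a + 3) - m := by omega
  rw [hn', show a + 3 - 3 = a by omega, show a + 3 - 2 = a + 1 by omega,
    show a + 3 - m = d + 2 by omega, ← hN]
  have hK : 3 * (a + 3) - m - 2 = 2 * a + d + 6 := by omega
  rw [hK]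
  have hsum : ∑ i ∈ Finset.Icc 1 a, (-1 : ℝ) ^ i / i * ((a + 3).choose i : ℝ) *
        ((d + 2 + (a + 3) + i).choose (a + 3) : ℝ)
      = ∑ k ∈ Finset.range a, (-1 : ℝ) ^ (k + 1) / (k + 1) * ((a + 3).choose (k + 1) : ℝ) *
        ((d + 2 + (a + 3) + (k + 1)).choose (a + 3) : ℝ) := by
    rw [← Finset.Ico_add_one_right_eq_Icc, Finset.sum_Ico_eq_sum_range]
    refine Finset.sum_congr (by simp) fun k _ => ?_
    rw [add_comm 1 k]
    push_cast
    rfl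
  rw [hsum]
  rw [Finset.sum_range_succ, Finset.sum_range_succ, Finset.sum_range_succ] at hfull
  rw [show d + 2 + (a + 3) + (a + 1) = 2 * a + d + 6 by ring,
    show d + 2 + (a + 3) + (a + 1 + 1) = 2 * a + d + 7 by ring,
    show d + 2 + (a + 3) + (a + 2 + 1) = 2 * a + d + 8 by ring] at hfull
  have hp1 (N k : ℕ) : ((N + 1).choose (k + 1) : ℝ) = N.choose k + N.choose (k + 1) := by
    exact_mod_cast Nat.choose_succ_succ N k
  have hc3 : ((a + 3).choose (a + 2 + 1) : ℝ) = 1 := by simp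
  have hc2 : ((a + 3).choose (a + 1 + 1) : ℝ) = a + 3 := by
    exact_mod_cast Nat.choose_succ_self_right (a + 2)
  have hc1 : ((a + 3).choose (a + 1) : ℝ) = (a + 3) * (a + 2) / 2 := by
    rw [Nat.choose_symm_of_eq_add (show a + 3 = (a + 1) + 2 by ring), Nat.cast_choose_two]
    push_cast
    ring
  have h1 : ((2 * a + d + 6).choose (a + 2) : ℝ) =
      (2 * a + d + 6).choose (a + 1) * (a + d + 5) / (a + 2) := by
    have h := Nat.choose_succ_right_eq (2 * a + d + 6) (a + 1)
    rw [show 2 * a + d + 6 - (a + 1) = a + d + 5 by omega] at h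
    rw [eq_div_iff (by positivity)]
    exact_mod_cast h
  have h2 : ((2 * a + d + 6).choose (a + 3) : ℝ) =
      (2 * a + d + 6).choose (a + 2) * (a + d + 4) / (a + 3) := by
    have h := Nat.choose_succ_right_eq (2 * a + d + 6) (a + 2)
    rw [show 2 * a + d + 6 - (a + 2) = a + d + 4 by omega] at h
    rw [eq_div_iff (by positivity)]
    exact_mod_cast h
  rw [hc1, hc2, hc3, hp1 (2 * a + d + 7) (a + 2), hp1 (2 * a + d + 6) (a + 1),
    hp1 (2 * a + d + 6) (a + 2), h2, h1] at hfull
  have hmR : (m : ℝ) = a + 1 - d := by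
    have : (m : ℝ) + d = a + 1 := by exact_mod_cast ha
    linarith
  rw [hmR]
  push_cast at hfull ⊢
  rw [show (a : ℝ) + 3 - 2 = a + 1 by ring, show (a : ℝ) + 3 - 1 = a + 2 by ring]
  simp only [pow_succ (-1 : ℝ)] at hfull ⊢
  rw [← sub_eq_zero] at hfull ⊢
  rw [← hfull]
  field_simp
  ring
end

section
/- The evaluations Z_l(0,0) = Z_r(0,0) = (2/5)·ζ(2)² and Z_l(1,0) = Z_r(1,0) = 277/16 - (32/5)·ζ(2)² hold, where ζ(2) = π²/6. -/
open scoped BigOperators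

theorem hasSum_nat_add_one {f : ℕ → ℝ} {a : ℝ} (h : HasSum f a) :
    HasSum (fun k => f (k + 1)) (a - f 0) := by
  have := (hasSum_nat_add_iff' 1).2 h
  simpa using this

theorem hasSum_inv_pow_shifts {p : ℕ} {Z : ℝ}
    (h : HasSum (fun k : ℕ => 1 / (k : ℝ) ^ p) Z) (hp : p ≠ 0) :
    HasSum (fun k : ℕ => 1 / ((k : ℝ) + 1) ^ p) Z ∧
    HasSum (fun k : ℕ => 1 / ((k : ℝ) + 2) ^ p) (Z - 1) ∧
    HasSum (fun k : ℕ => 1 / ((k : ℝ) + 3) ^ p) (Z - 1 - 1 / 2 ^ p) := by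
  have h1 := hasSum_nat_add_one h
  have h2 := hasSum_nat_add_one h1
  have h3 := hasSum_nat_add_one h2
  refine ⟨?_, ?_, ?_⟩
  · convert h1 using 1
    · ext k; push_cast; ring
    · simp [hp]
  · convert h2 using 1
    · ext k; push_cast; ring
    · simp [hp]
  · convert h3 using 1
    · ext k; push_cast; ring
    · norm_num [hp]

theorem hasSum_inv_pow_four_shifts :
    HasSum (fun k : ℕ => 1 / ((k : ℝ) + 1) ^ 4) (Real.pi ^ 4 / 90) ∧
    HasSum (fun k : ℕ => 1 / ((k : ℝ) + 2) ^ 4) (Real.pi ^ 4 / 90 - 1) ∧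
    HasSum (fun k : ℕ => 1 / ((k : ℝ) + 3) ^ 4) (Real.pi ^ 4 / 90 - 1 - 1 / 2 ^ 4) :=
  hasSum_inv_pow_shifts hasSum_zeta_four (by norm_num)

theorem hasDerivAt_inv_add_pow (c : ℝ) (p : ℕ) {t : ℝ} (h : t + c ≠ 0) :
    HasDerivAt (fun t : ℝ => 1 / (t + c) ^ p) (-p * (1 / (t + c) ^ (p + 1))) t := by
  have h1 := (((hasDerivAt_id t).add_const c).pow p).inv (pow_ne_zero p h)
  refine (h1.congr_of_eventuallyEq (.of_forall fun x => by simp)).congr_deriv ?_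
  rcases p with _ | p
  · simp
  · simp only [Nat.add_sub_cancel, Pi.pow_apply, id]
    field_simp
    ring

theorem R_zero_zero (t : ℝ) : R 0 0 t = 1 / (t + 0) ^ 3 := by
  by_cases h : t = 0
  · simp [R, poch, h]
  · simp [R, poch]
    field_simp

theorem Rtilde_zero_zero (t : ℝ) : Rtilde 0 0 t = 1 / (t + 0) ^ 2 := by
  simp [Rtilde, poch]
  ring

theorem R_one_zero {t : ℝ} (h : 0 < t) :
    R 1 0 t = 3 * (1 / (t + 0) ^ 4) - 3 * (1 / (t + 1) ^ 4) - 8 * (1 / (t + 0) ^ 3)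
      - 8 * (1 / (t + 1) ^ 3) + 33 / 4 * (1 / (t + 0) ^ 2) - 33 / 4 * (1 / (t + 1) ^ 2) := by
  have h1 : t + 1 ≠ 0 := by positivity
  have h2 : t + 2 ≠ 0 := by positivity
  have h3 : t + 1 + 1 ≠ 0 := by positivity
  simp [R, poch, Finset.prod_range_succ]
  field_simp
  ring

theorem Rtilde_one_zero {t : ℝ} (h : 0 < t) :
    Rtilde 1 0 t = 3 / 2 * (1 / (t + 0) ^ 1) + 18 * (1 / (t + 1) ^ 1) - 16 * (1 / (t + 1) ^ 2)
      - 39 / 2 * (1 / (t + 2) ^ 1) := by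
  have h1 : t + 1 ≠ 0 := by positivity
  have h2 : t + 2 ≠ 0 := by positivity
  simp [Rtilde, poch, Finset.prod_range_succ, Finset.sum_range_succ]
  field_simp
  ring

theorem deriv_R_zero_zero {t : ℝ} (h : 0 < t) : deriv (R 0 0) t = -3 * (1 / t ^ 4) := by
  rw [funext R_zero_zero, (hasDerivAt_inv_add_pow 0 3 (by positivity)).deriv]
  norm_num

theorem deriv_deriv_Rtilde_zero_zero {t : ℝ} (h : 0 < t) :
    deriv (deriv (Rtilde 0 0)) t = 6 * (1 / t ^ 4) := by
  have h1 : deriv (Rtilde 0 0) =ᶠ[nhds t] fun x => -(2 : ℕ) * (1 / (x + 0) ^ 3) := by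
    filter_upwards [lt_mem_nhds h] with x hx
    rw [funext Rtilde_zero_zero, (hasDerivAt_inv_add_pow 0 2 (by positivity)).deriv]
  rw [h1.deriv_eq, ((hasDerivAt_inv_add_pow 0 3 (by positivity)).const_mul _).deriv]
  norm_num
  ring

theorem deriv_R_one_zero {t : ℝ} (h : 0 < t) :
    deriv (R 1 0) t = -12 * (1 / t ^ 5) + 12 * (1 / (t + 1) ^ 5) + 24 * (1 / t ^ 4)
      + 24 * (1 / (t + 1) ^ 4) - 33 / 2 * (1 / t ^ 3) + 33 / 2 * (1 / (t + 1) ^ 3) := by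
  have h1 := Filter.eventuallyEq_of_mem (lt_mem_nhds h) fun x hx => R_one_zero hx
  have d (p : ℕ) := hasDerivAt_inv_add_pow 0 p (t := t) (by positivity)
  have e (p : ℕ) := hasDerivAt_inv_add_pow 1 p (t := t) (by positivity)
  have key := ((((((d 4).const_mul 3).sub ((e 4).const_mul 3)).sub ((d 3).const_mul 8)).sub
    ((e 3).const_mul 8)).add ((d 2).const_mul (33 / 4))).sub ((e 2).const_mul (33 / 4))
  rw [(key.congr_of_eventuallyEq h1).deriv]
  norm_num
  ring

theorem deriv_deriv_Rtilde_one_zero {t : ℝ} (h : 0 < t) :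
    deriv (deriv (Rtilde 1 0)) t = 3 * (1 / t ^ 3) + 36 * (1 / (t + 1) ^ 3)
      - 96 * (1 / (t + 1) ^ 4) - 39 * (1 / (t + 2) ^ 3) := by
  have d {c : ℝ} (hc : 0 ≤ c) (p : ℕ) {x : ℝ} (hx : 0 < x) :=
    hasDerivAt_inv_add_pow c p (t := x) (by positivity)
  have h1 {x : ℝ} (hx : 0 < x) :=
    ((((((d le_rfl 1 hx).const_mul (3 / 2)).add ((d zero_le_one 1 hx).const_mul 18)).sub
      ((d zero_le_one 2 hx).const_mul 16)).sub
      ((d zero_le_two 1 hx).const_mul (39 / 2))).congr_of_eventuallyEq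
      (Filter.eventuallyEq_of_mem (lt_mem_nhds hx) fun y hy => Rtilde_one_zero hy)).deriv
  have h2 := Filter.eventuallyEq_of_mem (lt_mem_nhds h) fun x hx => h1 hx
  have key := (((((d le_rfl 2 h).const_mul (-((1 : ℕ) : ℝ))).const_mul (3 / 2)).add
    (((d zero_le_one 2 h).const_mul (-((1 : ℕ) : ℝ))).const_mul 18)).sub
    (((d zero_le_one 3 h).const_mul (-((2 : ℕ) : ℝ))).const_mul 16)).sub
    (((d zero_le_two 2 h).const_mul (-((1 : ℕ) : ℝ))).const_mul (39 / 2))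
  rw [(key.congr_of_eventuallyEq h2).deriv]
  norm_num
  ring

theorem Zl_zero_zero : Zl 0 0 = Real.pi ^ 4 / 90 := by
  have key := hasSum_inv_pow_four_shifts.1.mul_left (-3)
  have h (ν : ℕ) : deriv (R 0 0) (((0 : ℕ) : ℝ) - (0 : ℕ) + 1 + ν) = -3 * (1 / ((ν : ℝ) + 1) ^ 4) := by
    rw [deriv_R_zero_zero (by norm_num; positivity)]
    norm_num
    ring
  rw [Zl, tsum_congr h, key.tsum_eq]
  ring

theorem Zr_zero_zero : Zr 0 0 = Real.pi ^ 4 / 90 := by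
  have key := hasSum_inv_pow_four_shifts.1.mul_left 6
  have h (ν : ℕ) : deriv (deriv (Rtilde 0 0)) (1 + (ν : ℝ)) = 6 * (1 / ((ν : ℝ) + 1) ^ 4) := by
    rw [deriv_deriv_Rtilde_zero_zero (by positivity)]
    ring
  rw [Zr, tsum_congr h, key.tsum_eq]
  ring

theorem Zl_one_zero : Zl 1 0 = 277 / 16 - 16 * (Real.pi ^ 4 / 90) := by
  obtain ⟨-, a3, b3⟩ := hasSum_inv_pow_shifts
    (Real.summable_one_div_nat_pow.2 (by norm_num : 1 < 3)).hasSum (by norm_num)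
  obtain ⟨-, a4, b4⟩ := hasSum_inv_pow_four_shifts
  obtain ⟨-, a5, b5⟩ := hasSum_inv_pow_shifts
    (Real.summable_one_div_nat_pow.2 (by norm_num : 1 < 5)).hasSum (by norm_num)
  have key := (((((a5.mul_left (-12)).add (b5.mul_left 12)).add (a4.mul_left 24)).add
    (b4.mul_left 24)).sub (a3.mul_left (33 / 2))).add (b3.mul_left (33 / 2))
  have h (ν : ℕ) : deriv (R 1 0) (((1 : ℕ) : ℝ) - (0 : ℕ) + 1 + ν) =
      -12 * (1 / ((ν : ℝ) + 2) ^ 5) + 12 * (1 / ((ν : ℝ) + 3) ^ 5) + 24 * (1 / ((ν : ℝ) + 2) ^ 4)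
        + 24 * (1 / ((ν : ℝ) + 3) ^ 4) - 33 / 2 * (1 / ((ν : ℝ) + 2) ^ 3)
        + 33 / 2 * (1 / ((ν : ℝ) + 3) ^ 3) := by
    rw [show ((1 : ℕ) : ℝ) - (0 : ℕ) + 1 + ν = ν + 2 by norm_num; ring,
      deriv_R_one_zero (by positivity), show (ν : ℝ) + 2 + 1 = ν + 3 by ring]
  rw [Zl, tsum_congr h, key.tsum_eq]
  ring

theorem Zr_one_zero : Zr 1 0 = 277 / 16 - 16 * (Real.pi ^ 4 / 90) := by
  obtain ⟨a3, b3, c3⟩ := hasSum_inv_pow_shifts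
    (Real.summable_one_div_nat_pow.2 (by norm_num : 1 < 3)).hasSum (by norm_num)
  have key := (((a3.mul_left 3).add (b3.mul_left 36)).sub
    (hasSum_inv_pow_four_shifts.2.1.mul_left 96)).sub (c3.mul_left 39)
  have h (ν : ℕ) : deriv (deriv (Rtilde 1 0)) (1 + (ν : ℝ)) =
      3 * (1 / ((ν : ℝ) + 1) ^ 3) + 36 * (1 / ((ν : ℝ) + 2) ^ 3) - 96 * (1 / ((ν : ℝ) + 2) ^ 4)
        - 39 * (1 / ((ν : ℝ) + 3) ^ 3) := by
    rw [deriv_deriv_Rtilde_one_zero (by positivity), show 1 + (ν : ℝ) + 1 = ν + 2 by ring,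
      show 1 + (ν : ℝ) + 2 = ν + 3 by ring, add_comm 1 (ν : ℝ)]
  rw [Zr, tsum_congr h, key.tsum_eq]
  ring

/-- The initial values `Z_l(0,0) = Z_r(0,0) = (2/5) ζ(2)²` and
`Z_l(1,0) = Z_r(1,0) = 277/16 - (32/5) ζ(2)²`. -/
theorem initial_values_m_zero :
    Zl 0 0 = 2 / 5 * (Real.pi ^ 2 / 6) ^ 2 ∧
    Zr 0 0 = 2 / 5 * (Real.pi ^ 2 / 6) ^ 2 ∧
    Zl 1 0 = 277 / 16 - 32 / 5 * (Real.pi ^ 2 / 6) ^ 2 ∧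
    Zr 1 0 = 277 / 16 - 32 / 5 * (Real.pi ^ 2 / 6) ^ 2 := by
  rw [Zl_zero_zero, Zr_zero_zero, Zl_one_zero, Zr_one_zero]
  refine ⟨?_, ?_, ?_, ?_⟩ <;> ring
end

section
/- The evaluations Z_l(1,1) = Z_r(1,1) = -13 + (24/5)·ζ(2)² and Z_l(2,1) = Z_r(2,1) = 4090247/1944 - (3888/5)·ζ(2)² hold, where ζ(2) = π²/6. -/
open scoped BigOperators

/-- The partial fraction sum `Σ_{i,k} M i k / (t + i)^(k + e)`. -/
noncomputable def partialFractions {N K : ℕ} (M : Matrix (Fin N) (Fin K) ℝ) (e : ℕ) (t : ℝ) : ℝ :=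
  ∑ i, ∑ k, M i k * ((t + (i : ℕ)) ^ ((k : ℕ) + e))⁻¹

/-- The coefficients of the derivative of a partial fraction sum. -/
def derivCoeff {N K : ℕ} (M : Matrix (Fin N) (Fin K) ℝ) (e : ℕ) : Matrix (Fin N) (Fin K) ℝ :=
  fun i k => -((k : ℕ) + e : ℝ) * M i k

theorem hasDerivAt_partialFractions {N K : ℕ} (M : Matrix (Fin N) (Fin K) ℝ) (e : ℕ) {t : ℝ}
    (ht : 0 < t) :
    HasDerivAt (partialFractions M e) (partialFractions (derivCoeff M e) (e + 1) t) t := by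
  unfold partialFractions derivCoeff
  refine HasDerivAt.fun_sum fun i _ => HasDerivAt.fun_sum fun k _ => ?_
  have hpos : 0 < t + (i : ℕ) := by positivity
  have h := ((hasDerivAt_zpow (-(((k : ℕ) + e : ℕ) : ℤ)) (t + (i : ℕ))
    (Or.inl hpos.ne')).comp_add_const t ((i : ℕ) : ℝ)).const_mul (M i k)
  have hexp : -(((k : ℕ) + e : ℕ) : ℤ) - 1 = -(((k : ℕ) + (e + 1) : ℕ) : ℤ) := by
    push_cast
    ring
  rw [hexp] at h
  simp only [zpow_neg, zpow_natCast] at h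
  refine h.congr_deriv ?_
  push_cast
  ring

theorem deriv_eq_partialFractions {f : ℝ → ℝ} {N K : ℕ} {M : Matrix (Fin N) (Fin K) ℝ} {e : ℕ}
    (hf : ∀ t, 0 < t → f t = partialFractions M e t) {t : ℝ} (ht : 0 < t) :
    deriv f t = partialFractions (derivCoeff M e) (e + 1) t := by
  have h : f =ᶠ[nhds t] partialFractions M e := by
    filter_upwards [lt_mem_nhds ht] with x hx using hf x hx
  rw [h.deriv_eq, (hasDerivAt_partialFractions M e ht).deriv]

/-- The zeta value `Σ_{n ≥ 1} 1 / n^p`. -/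
noncomputable def zetaSum (p : ℕ) : ℝ := ∑' n : ℕ, (((n : ℝ) + 1) ^ p)⁻¹

theorem hasSum_zetaSum {p : ℕ} (hp : 2 ≤ p) :
    HasSum (fun n : ℕ => (((n : ℝ) + 1) ^ p)⁻¹) (zetaSum p) := by
  have h := (summable_nat_add_iff 1).2 (Real.summable_nat_pow_inv.2 hp)
  exact Summable.hasSum (by simpa using h)

theorem zetaSum_four : zetaSum 4 = Real.pi ^ 4 / 90 := by
  have h := (hasSum_nat_add_iff' 1).2 hasSum_zeta_four
  simp only [Finset.sum_range_one, Nat.cast_zero, Nat.cast_add, Nat.cast_one, one_div] at h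
  have h' := (hasSum_zetaSum (p := 4) (by norm_num)).unique h
  simpa using h'

theorem hasSum_partialFractions {N K : ℕ} (M : Matrix (Fin N) (Fin K) ℝ) {e : ℕ} (he : 2 ≤ e)
    (s : ℕ) :
    HasSum (fun ν : ℕ => partialFractions M e (((s + 1 : ℕ) : ℝ) + ν))
      (∑ i : Fin N, ∑ k : Fin K, M i k * (zetaSum ((k : ℕ) + e) -
        ∑ j ∈ Finset.range (s + i), (((j : ℝ) + 1) ^ ((k : ℕ) + e))⁻¹)) := by
  unfold partialFractions
  refine hasSum_sum fun i _ => hasSum_sum fun k _ => HasSum.mul_left _ ?_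
  have h := (hasSum_nat_add_iff' (s + (i : ℕ))).2
    (hasSum_zetaSum (p := (k : ℕ) + e) (by omega))
  refine Eq.mp (congrArg (HasSum · _) (funext fun ν => ?_)) h
  push_cast
  congr 2
  ring

theorem tsum_deriv_of_eq_partialFractions {f : ℝ → ℝ} {N K : ℕ} {M : Matrix (Fin N) (Fin K) ℝ}
    (hf : ∀ t, 0 < t → f t = partialFractions M 1 t) (s : ℕ) :
    ∑' ν : ℕ, deriv f (((s + 1 : ℕ) : ℝ) + ν) =
      ∑ i : Fin N, ∑ k : Fin K, derivCoeff M 1 i k * (zetaSum ((k : ℕ) + 2) -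
        ∑ j ∈ Finset.range (s + i), (((j : ℝ) + 1) ^ ((k : ℕ) + 2))⁻¹) := by
  rw [← (hasSum_partialFractions (derivCoeff M 1) le_rfl s).tsum_eq]
  exact tsum_congr fun ν => deriv_eq_partialFractions hf (by positivity)

theorem tsum_deriv_deriv_of_eq_partialFractions {f : ℝ → ℝ} {N K : ℕ}
    {M : Matrix (Fin N) (Fin K) ℝ} (hf : ∀ t, 0 < t → f t = partialFractions M 1 t) (s : ℕ) :
    ∑' ν : ℕ, deriv (deriv f) (((s + 1 : ℕ) : ℝ) + ν) =
      ∑ i : Fin N, ∑ k : Fin K, derivCoeff (derivCoeff M 1) 2 i k * (zetaSum ((k : ℕ) + 3) -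
        ∑ j ∈ Finset.range (s + i), (((j : ℝ) + 1) ^ ((k : ℕ) + 3))⁻¹) := by
  rw [← (hasSum_partialFractions (derivCoeff (derivCoeff M 1) 2) (by norm_num) s).tsum_eq]
  exact tsum_congr fun ν =>
    deriv_eq_partialFractions (fun t ht => deriv_eq_partialFractions hf ht) (by positivity)

theorem R_one_one_eq (t : ℝ) (ht : 0 < t) :
    R 1 1 t = partialFractions
      (!![0, -13/2, 6, -2; 0, 13/2, 6, 2] : Matrix (Fin 2) (Fin 4) ℝ) 1 t := by
  have h0 : t ≠ 0 := ht.ne'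
  have h1 : t + 1 ≠ 0 := by positivity
  simp [R, poch, partialFractions, Finset.prod_range_succ, Fin.sum_univ_succ,
    Nat.factorial]
  norm_num
  field_simp
  ring

theorem Rtilde_one_one_eq (t : ℝ) (ht : 0 < t) :
    Rtilde 1 1 t = partialFractions
      (!![-9, 2; 9, 10] : Matrix (Fin 2) (Fin 2) ℝ) 1 t := by
  have h0 : t ≠ 0 := ht.ne'
  have h1 : t + 1 ≠ 0 := by positivity
  simp [Rtilde, poch, partialFractions, Finset.prod_range_succ, Finset.sum_range_succ,
    Fin.sum_univ_succ, Nat.factorial, Nat.choose]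
  norm_num
  field_simp
  ring

theorem R_two_one_eq (t : ℝ) (ht : 0 < t) :
    R 2 1 t = partialFractions
      (!![5988, -15049/6, 756, -120; -11976, 0, -3456, 0; 5988, 15049/6, 756, 120] : Matrix (Fin 3) (Fin 4) ℝ) 1 t := by
  have h0 : t ≠ 0 := ht.ne'
  have h1 : t + 1 ≠ 0 := by positivity
  have h2 : t + 2 ≠ 0 := by positivity
  have h3 : t + 3 ≠ 0 := by positivity
  simp [R, poch, partialFractions, Finset.prod_range_succ, Fin.sum_univ_succ,
    Nat.factorial]
  norm_num
  field_simp
  ring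

theorem Rtilde_two_one_eq (t : ℝ) (ht : 0 < t) :
    Rtilde 2 1 t = partialFractions
      (!![10/3, 0; 1131, -324; -291, -1620; -2530/3, 0] : Matrix (Fin 4) (Fin 2) ℝ) 1 t := by
  have h0 : t ≠ 0 := ht.ne'
  have h1 : t + 1 ≠ 0 := by positivity
  have h2 : t + 2 ≠ 0 := by positivity
  have h3 : t + 3 ≠ 0 := by positivity
  simp [Rtilde, poch, partialFractions, Finset.prod_range_succ, Finset.sum_range_succ,
    Fin.sum_univ_succ, Nat.factorial, Nat.choose]
  norm_num
  field_simp
  ring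

/-- The initial values `Z_l(1,1) = Z_r(1,1) = -13 + (24/5) ζ(2)²` and
`Z_l(2,1) = Z_r(2,1) = 4090247/1944 - (3888/5) ζ(2)²`. -/
theorem initial_values_m_one :
    Zl 1 1 = -13 + 24 / 5 * (Real.pi ^ 2 / 6) ^ 2 ∧
    Zr 1 1 = -13 + 24 / 5 * (Real.pi ^ 2 / 6) ^ 2 ∧
    Zl 2 1 = 4090247 / 1944 - 3888 / 5 * (Real.pi ^ 2 / 6) ^ 2 ∧
    Zr 2 1 = 4090247 / 1944 - 3888 / 5 * (Real.pi ^ 2 / 6) ^ 2 := by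
  refine ⟨?_, ?_, ?_, ?_⟩
  · have h := tsum_deriv_of_eq_partialFractions R_one_one_eq 0
    simp [derivCoeff, Fin.sum_univ_succ, zetaSum_four] at h
    norm_num [zetaSum_four] at h
    norm_num [Zl, h]
    ring
  · have h := tsum_deriv_deriv_of_eq_partialFractions Rtilde_one_one_eq 0
    simp [derivCoeff, Fin.sum_univ_succ, zetaSum_four] at h
    norm_num [zetaSum_four] at h
    norm_num [Zr, h]
    ring
  · have h := tsum_deriv_of_eq_partialFractions R_two_one_eq 1
    simp [derivCoeff, Fin.sum_univ_succ, Finset.sum_range_succ, zetaSum_four] at h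
    norm_num [zetaSum_four] at h
    norm_num [Zl, h]
    ring
  · have h := tsum_deriv_deriv_of_eq_partialFractions Rtilde_two_one_eq 0
    simp [derivCoeff, Fin.sum_univ_succ, Finset.sum_range_succ, zetaSum_four] at h
    norm_num [zetaSum_four] at h
    norm_num [Zr, h]
    ring
end
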